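/- arXiv:2604.15947 — 9 statements merged into one kernel-verified Lean document; each statement's English description precedes it below -/
import Mathlib

section
/- There exist ε₀ > 0 and D > 0 with the following property: for every ε with 0 < ε < ε₀ and every x₀ ∈ ℝ³, r > 0, R > 0, t > 0 satisfying r ≤ ε·‖x₀‖, R ≤ ε·‖x₀‖ and R ≤ ε₀·t, the Lebesgue measure of the set C(x₀,r,R,t) := B(x₀,r) ∩ {x ∈ ℝ³ : t − R ≤ ‖x‖ ≤ t + R} satisfies volume(C(x₀,r,R,t)) ≤ D · t² · R · ε. -/
open MeasureTheory

/-- If the translates of `A ⊆ B(x₀, r)` by `0, v, …, (n - 1) v` are pairwise disjoint and these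
translations move points by at most `s`, then `n` copies of `A` fit into `B(x₀, r + s)`. -/
lemma card_mul_measure_le_of_disjoint_translates {E : Type*} [NormedAddCommGroup E]
    [NormedSpace ℝ E] [MeasurableSpace E] [BorelSpace E] (μ : Measure E)
    [μ.IsAddRightInvariant] {A : Set E} (hA : MeasurableSet A) {x₀ v : E} {r s : ℝ}
    (hAr : A ⊆ Metric.ball x₀ r) (n : ℕ) (hs : ∀ k < n, (k : ℝ) * ‖v‖ ≤ s)
    (hv : ∀ y ∈ A, ∀ k : ℕ, 0 < k → y + (k : ℝ) • v ∉ A) :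
    (n : ENNReal) * μ A ≤ μ (Metric.ball x₀ (r + s)) := by
  let B : ℕ → Set E := fun k => (fun z => z + -((k : ℝ) • v)) ⁻¹' A
  have hdisj_lt : ∀ i j : ℕ, i < j → Disjoint (B i) (B j) := by
    intro i j hij
    refine Set.disjoint_left.2 fun z hi hj => ?_
    refine hv _ hj (j - i) (Nat.sub_pos_of_lt hij) ?_
    have : z + -((j : ℝ) • v) + ((j - i : ℕ) : ℝ) • v = z + -((i : ℝ) • v) := by
      rw [Nat.cast_sub hij.le]
      module
    rw [this]
    exact hi
  have hdisj : Pairwise (Function.onFun Disjoint B) := fun i j hij =>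
    hij.lt_or_gt.elim (hdisj_lt i j) fun h => (hdisj_lt j i h).symm
  have hsum : μ (⋃ k ∈ Finset.range n, B k) = n * μ A := by
    rw [measure_biUnion_finset (fun i _ j _ hij => hdisj hij)
      fun k _ => hA.preimage (measurable_id.add_const _)]
    simp [B, measure_preimage_add_right]
  rw [← hsum]
  refine measure_mono (Set.iUnion₂_subset fun k hk z hz => ?_)
  have hball := mem_ball_iff_norm.1 (hAr hz)
  have hshift : ‖(k : ℝ) • v‖ ≤ s := by
    simpa [norm_smul] using hs k (Finset.mem_range.1 hk)
  rw [mem_ball_iff_norm]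
  calc ‖z - x₀‖ = ‖(z + -((k : ℝ) • v) - x₀) + (k : ℝ) • v‖ := by congr 1; abel
    _ ≤ ‖z + -((k : ℝ) • v) - x₀‖ + ‖(k : ℝ) • v‖ := norm_add_le _ _
    _ < r + s := by linarith

/-- Moving radially by `s • x₀` inside a ball far from the origin increases the norm by at least
`3 / 5` of the displacement. -/
lemma norm_add_smul_ge_of_mem_ball {E : Type*} [NormedAddCommGroup E] [InnerProductSpace ℝ E]
    {x₀ y : E} {r s : ℝ} (hx₀ : 0 < ‖x₀‖) (hr : r ≤ ‖x₀‖ / 4) (hs : 0 ≤ s)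
    (hy : y ∈ Metric.ball x₀ r) (hys : y + s • x₀ ∈ Metric.ball x₀ r) :
    ‖y‖ + 3 / 5 * (s * ‖x₀‖) ≤ ‖y + s • x₀‖ := by
  have upper : ∀ z ∈ Metric.ball x₀ r, ‖z‖ ≤ 5 / 4 * ‖x₀‖ := fun z hz => by
    have h := norm_le_norm_add_norm_sub x₀ z
    rw [norm_sub_rev] at h
    linarith [mem_ball_iff_norm.1 hz]
  have hinner : 3 / 4 * ‖x₀‖ ^ 2 ≤ inner ℝ y x₀ := by
    have h : inner ℝ y x₀ = inner ℝ (y - x₀) x₀ + ‖x₀‖ ^ 2 := by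
      rw [inner_sub_left, real_inner_self_eq_norm_sq]; ring
    have h' := neg_le_of_abs_le (abs_real_inner_le_norm (y - x₀) x₀)
    nlinarith [mem_ball_iff_norm.1 hy]
  have hsq : ‖y + s • x₀‖ ^ 2 = ‖y‖ ^ 2 + 2 * (s * inner ℝ y x₀) + (s * ‖x₀‖) ^ 2 := by
    rw [norm_add_sq_real, real_inner_smul_right, norm_smul, Real.norm_of_nonneg hs]
  have hsi := mul_le_mul_of_nonneg_left hinner hs
  by_contra! hlt
  have h1 := upper y hy
  have h2 := upper _ hys
  have hmono : ‖y‖ ≤ ‖y + s • x₀‖ :=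
    abs_le_of_sq_le_sq' (by nlinarith [sq_nonneg (s * ‖x₀‖), mul_nonneg hs (sq_nonneg ‖x₀‖)])
      (norm_nonneg _) |>.2
  have hsum : ‖y + s • x₀‖ + ‖y‖ ≤ 5 / 2 * ‖x₀‖ := by linarith
  have hpos : 0 < s * ‖x₀‖ := by linarith
  have hprod : (‖y + s • x₀‖ - ‖y‖) * (‖y + s • x₀‖ + ‖y‖)
      ≤ 3 / 5 * (s * ‖x₀‖) * (5 / 2 * ‖x₀‖) :=
    mul_le_mul (by linarith) hsum (by positivity) (by positivity)
  nlinarith [sq_pos_of_pos hpos]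

/-- A spherical shell of half-width `R` meets a ball of radius `r` far from the origin in a set of
volume at most a constant times `r ^ 2 * R`. -/
lemma volume_ball_inter_shell_le {x₀ : EuclideanSpace ℝ (Fin 3)} {r R : ℝ} (t : ℝ)
    (hr : 0 < r) (hR : 0 < R) (hrx : r ≤ ‖x₀‖ / 4) :
    volume (Metric.ball x₀ r ∩ {x : EuclideanSpace ℝ (Fin 3) | t - R ≤ ‖x‖ ∧ ‖x‖ ≤ t + R})
      ≤ ENNReal.ofReal (216 * r ^ 2 * R) *
        volume (Metric.ball (0 : EuclideanSpace ℝ (Fin 3)) 1) := by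
  set A := Metric.ball x₀ r ∩ {x : EuclideanSpace ℝ (Fin 3) | t - R ≤ ‖x‖ ∧ ‖x‖ ≤ t + R}
  have hx₀ : 0 < ‖x₀‖ := by linarith
  have hA : MeasurableSet A :=
    measurableSet_ball.inter ((measurableSet_le measurable_const measurable_norm).inter
      (measurableSet_le measurable_norm measurable_const))
  have hnorm : ‖(5 * R / ‖x₀‖) • x₀‖ = 5 * R := by
    rw [norm_smul, Real.norm_of_nonneg (by positivity)]
    field_simp
  have hpack : (⌈r / R⌉₊ : ENNReal) * volume A ≤ volume (Metric.ball x₀ (r + 5 * r)) := by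
    refine card_mul_measure_le_of_disjoint_translates volume hA (v := (5 * R / ‖x₀‖) • x₀)
      Set.inter_subset_left _ (fun k hk => ?_) fun y hy k hk hyk => ?_
    · have := (lt_div_iff₀ hR).1 (Nat.lt_ceil.1 hk)
      rw [hnorm]
      linarith
    · have hk1 : (1 : ℝ) ≤ k := by exact_mod_cast hk
      rw [smul_smul] at hyk
      have hgrow := norm_add_smul_ge_of_mem_ball hx₀ hrx (by positivity) hy.1 hyk.1
      have hstep : (k : ℝ) * (5 * R / ‖x₀‖) * ‖x₀‖ = k * (5 * R) := by field_simp
      rw [hstep] at hgrow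
      have h1 := hy.2.1
      have h2 := hyk.2.2
      nlinarith
  have hceil : ENNReal.ofReal (r / R) ≤ (⌈r / R⌉₊ : ENNReal) := by
    rw [← ENNReal.ofReal_natCast]
    exact ENNReal.ofReal_le_ofReal (Nat.le_ceil _)
  have hball : volume (Metric.ball x₀ (r + 5 * r)) =
      ENNReal.ofReal (216 * r ^ 3) * volume (Metric.ball (0 : EuclideanSpace ℝ (Fin 3)) 1) := by
    rw [Measure.addHaar_ball volume x₀ (by positivity), finrank_euclideanSpace_fin]
    congr 2
    ring
  have hone : ENNReal.ofReal (R / r) * ENNReal.ofReal (r / R) = 1 := by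
    rw [← ENNReal.ofReal_mul (by positivity), div_mul_div_cancel₀ hr.ne', div_self hR.ne',
      ENNReal.ofReal_one]
  calc volume A = ENNReal.ofReal (R / r) * (ENNReal.ofReal (r / R) * volume A) := by
        rw [← mul_assoc, hone, one_mul]
    _ ≤ ENNReal.ofReal (R / r) * (ENNReal.ofReal (216 * r ^ 3) *
          volume (Metric.ball (0 : EuclideanSpace ℝ (Fin 3)) 1)) := by
        rw [← hball]
        gcongr
        exact (mul_le_mul_left hceil _).trans hpack
    _ = _ := by
        rw [← mul_assoc, ← ENNReal.ofReal_mul (by positivity)]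
        congr 2
        field_simp

/-- **Geometric Lemma C.1.** There exist `ε₀ > 0` and `D > 0` such that for every
`0 < ε < ε₀` and every `x₀ ∈ ℝ³`, `r, R, t > 0` with `r ≤ ε‖x₀‖`, `R ≤ ε‖x₀‖` and
`R ≤ ε₀ t`, the volume of `B(x₀, r) ∩ {t - R ≤ ‖x‖ ≤ t + R}` is at most `D t² R ε`. -/
theorem stmt0 :
    ∃ ε₀ > (0 : ℝ), ∃ D > (0 : ℝ),
      ∀ (ε : ℝ), 0 < ε → ε < ε₀ →
      ∀ (x₀ : EuclideanSpace ℝ (Fin 3)) (r R t : ℝ),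
        0 < r → 0 < R → 0 < t →
        r ≤ ε * ‖x₀‖ → R ≤ ε * ‖x₀‖ → R ≤ ε₀ * t →
        volume (Metric.ball x₀ r ∩ {x : EuclideanSpace ℝ (Fin 3) | t - R ≤ ‖x‖ ∧ ‖x‖ ≤ t + R})
          ≤ ENNReal.ofReal (D * t ^ 2 * R * ε) := by
  have hfin : volume (Metric.ball (0 : EuclideanSpace ℝ (Fin 3)) 1) ≠ ⊤ :=
    measure_ball_lt_top.ne
  have hV := ENNReal.toReal_pos (Metric.measure_ball_pos volume
    (0 : EuclideanSpace ℝ (Fin 3)) one_pos).ne' hfin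
  set V := (volume (Metric.ball (0 : EuclideanSpace ℝ (Fin 3)) 1)).toReal with hVdef
  refine ⟨1 / 4, by norm_num, 216 * V, by positivity, ?_⟩
  intro ε hε hε₀ x₀ r R t hr hR ht hrε _ hRt
  rcases Set.eq_empty_or_nonempty (Metric.ball x₀ r ∩
    {x : EuclideanSpace ℝ (Fin 3) | t - R ≤ ‖x‖ ∧ ‖x‖ ≤ t + R}) with hempty | ⟨x, hx, -, hxt⟩
  · rw [hempty, measure_empty]; exact zero_le
  have hrx : r ≤ ‖x₀‖ / 4 := by nlinarith [norm_nonneg x₀]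
  have hx₀t : ‖x₀‖ ≤ 5 / 3 * t := by
    have h := norm_le_norm_add_norm_sub x x₀
    linarith [mem_ball_iff_norm.1 hx]
  have hrt : r ≤ 5 / 3 * (ε * t) := by nlinarith
  have hr2 : r ^ 2 ≤ t ^ 2 * ε := by
    have h1 : r ^ 2 ≤ (5 / 3 * (ε * t)) ^ 2 := by gcongr
    have h2 : ε * (t ^ 2 * ε) ≤ 1 / 4 * (t ^ 2 * ε) := by gcongr
    nlinarith [mul_nonneg (sq_nonneg t) hε.le]
  refine (volume_ball_inter_shell_le t hr hR hrx).trans ?_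
  rw [← ENNReal.ofReal_toReal hfin, ← hVdef, ← ENNReal.ofReal_mul (by positivity)]
  refine ENNReal.ofReal_le_ofReal ?_
  calc 216 * r ^ 2 * R * V ≤ 216 * (t ^ 2 * ε) * R * V := by gcongr
    _ = 216 * V * t ^ 2 * R * ε := by ring
end

section
/- For every smooth compactly supported function f : ℝ³ → ℝ and every ε > 0, there exists a smooth compactly supported function g : ℝ³ → ℝ whose (closed) support does not contain the origin, such that (∫_{ℝ³} ‖∇(f − g)(x)‖² dx)^{1/2} ≤ ε. In other words, C_c^∞(ℝ³ \ {0}) is dense in C_c^∞(ℝ³) for the homogeneous Ḣ¹ seminorm, so that Ḣ¹₀(ℝ³ \ {0}) = Ḣ¹(ℝ³). -/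
open MeasureTheory

/-- Multiplying a `C¹` function by a cutoff rescaled to scale `δ ≤ 1` gives a gradient of
size `O(δ⁻¹)`. -/
lemma exists_norm_fderiv_mul_comp_smul_le {E : Type*} [NormedAddCommGroup E] [NormedSpace ℝ E]
    {f χ : E → ℝ} (hf : ContDiff ℝ 1 f) (hfs : HasCompactSupport f)
    (hχ : ContDiff ℝ 1 χ) (hχs : HasCompactSupport χ) :
    ∃ K : ℝ, ∀ δ : ℝ, 0 < δ → δ ≤ 1 → ∀ x : E,
      ‖fderiv ℝ (fun y => f y * χ (δ⁻¹ • y)) x‖ ≤ K * δ⁻¹ := by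
  obtain ⟨A, hA⟩ := hf.continuous.bounded_above_of_compact_support hfs
  obtain ⟨A', hA'⟩ :=
    (hf.continuous_fderiv one_ne_zero).bounded_above_of_compact_support (hfs.fderiv ℝ)
  obtain ⟨B, hB⟩ := hχ.continuous.bounded_above_of_compact_support hχs
  obtain ⟨B', hB'⟩ :=
    (hχ.continuous_fderiv one_ne_zero).bounded_above_of_compact_support (hχs.fderiv ℝ)
  have hA0 : 0 ≤ A := (norm_nonneg _).trans (hA 0)
  have hA'0 : 0 ≤ A' := (norm_nonneg _).trans (hA' 0)
  have hB0 : 0 ≤ B := (norm_nonneg _).trans (hB 0)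
  refine ⟨A * B' + B * A', fun δ hδ hδ1 x => ?_⟩
  have hinv : 1 ≤ δ⁻¹ := (one_le_inv₀ hδ).2 hδ1
  have hdχ : DifferentiableAt ℝ (fun y => χ (δ⁻¹ • y)) x :=
    ((hχ.differentiable one_ne_zero).comp (differentiable_id.const_smul δ⁻¹)) x
  rw [fderiv_fun_mul ((hf.differentiable one_ne_zero) x) hdχ, fderiv_comp_smul]
  calc _ ≤ ‖f x‖ * (‖δ⁻¹‖ * ‖fderiv ℝ χ (δ⁻¹ • x)‖) + ‖χ (δ⁻¹ • x)‖ * ‖fderiv ℝ f x‖ := by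
        refine (norm_add_le _ _).trans ?_
        simp only [norm_smul, le_refl]
    _ ≤ A * (δ⁻¹ * B') + B * A' := by
        rw [Real.norm_of_nonneg (inv_nonneg.2 hδ.le)]
        gcongr
        exacts [hA x, hB' _, hB _, hA' x]
    _ ≤ (A * B' + B * A') * δ⁻¹ := by
        have := le_mul_of_one_le_right (mul_nonneg hB0 hA'0) hinv
        linarith

/-- **Lemma A.1.** `C_c^∞(ℝ³ \ {0})` is dense in `C_c^∞(ℝ³)` for the homogeneous `Ḣ¹`
seminorm: for every smooth compactly supported `f : ℝ³ → ℝ` and every `ε > 0` there is a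
smooth compactly supported `g` whose closed support avoids the origin with
`‖∇(f - g)‖_{L²} ≤ ε`. Hence `Ḣ¹₀(ℝ³ \ {0}) = Ḣ¹(ℝ³)`. -/
theorem stmt1 (f : EuclideanSpace ℝ (Fin 3) → ℝ)
    (hf : ContDiff ℝ (⊤ : ℕ∞) f) (hfsupp : HasCompactSupport f)
    (ε : ℝ) (hε : 0 < ε) :
    ∃ g : EuclideanSpace ℝ (Fin 3) → ℝ,
      ContDiff ℝ (⊤ : ℕ∞) g ∧ HasCompactSupport g ∧
      (0 : EuclideanSpace ℝ (Fin 3)) ∉ tsupport g ∧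
      Real.sqrt (∫ x, ‖fderiv ℝ (fun y => f y - g y) x‖ ^ 2) ≤ ε := by
  let χ : ContDiffBump (0 : EuclideanSpace ℝ (Fin 3)) := ⟨1, 2, one_pos, one_lt_two⟩
  have hχ : ContDiff ℝ (⊤ : ℕ∞) χ := χ.contDiff
  obtain ⟨K, hK⟩ := exists_norm_fderiv_mul_comp_smul_le (hf.of_le (by simp)) hfsupp
    (hχ.of_le (by simp)) χ.hasCompactSupport
  set V : ℝ := volume.real (Metric.ball (0 : EuclideanSpace ℝ (Fin 3)) 1)
  have hV : 0 ≤ V := measureReal_nonneg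
  obtain ⟨δ, hδ, hδ1, hδε⟩ : ∃ δ : ℝ, 0 < δ ∧ δ ≤ 1 ∧ K ^ 2 * 8 * V * δ ≤ ε ^ 2 := by
    have hc : 0 < K ^ 2 * 8 * V + 1 := by positivity
    refine ⟨min 1 (ε ^ 2 / (K ^ 2 * 8 * V + 1)), by positivity, min_le_left _ _, ?_⟩
    calc _ ≤ (K ^ 2 * 8 * V + 1) * (ε ^ 2 / (K ^ 2 * 8 * V + 1)) := by
          gcongr
          · linarith
          · exact min_le_right _ _
      _ = ε ^ 2 := by field_simp
  refine ⟨fun x => f x * (1 - χ (δ⁻¹ • x)), ?_, hfsupp.mul_right, ?_, ?_⟩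
  · exact hf.mul (contDiff_const.sub (hχ.comp (contDiff_const_smul δ⁻¹)))
  · rw [notMem_tsupport_iff_eventuallyEq]
    filter_upwards [Metric.ball_mem_nhds (0 : EuclideanSpace ℝ (Fin 3)) hδ] with x hx
    have hx1 : χ (δ⁻¹ • x) = 1 := by
      apply χ.one_of_mem_closedBall
      rw [mem_closedBall_zero_iff, norm_smul, norm_inv, Real.norm_of_nonneg hδ.le,
        inv_mul_le_iff₀ hδ]
      simpa [χ] using (mem_ball_zero_iff.1 hx).le
    simp [hx1]
  · have heq : (fun y => f y - f y * (1 - χ (δ⁻¹ • y))) = fun y => f y * χ (δ⁻¹ • y) := by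
      ext y; ring
    rw [heq]
    refine Real.sqrt_le_iff.2 ⟨hε.le, ?_⟩
    set h : EuclideanSpace ℝ (Fin 3) → ℝ := fun y => f y * χ (δ⁻¹ • y)
    have hsupp : tsupport h ⊆ Metric.closedBall 0 (2 * δ) := by
      refine closure_minimal (fun x hx => ?_) Metric.isClosed_closedBall
      have hx' : δ⁻¹ • x ∈ Function.support χ := right_ne_zero_of_mul hx
      rw [χ.support_eq, mem_ball_zero_iff, norm_smul, norm_inv, Real.norm_of_nonneg hδ.le,
        inv_mul_lt_iff₀ hδ] at hx'
      rw [mem_closedBall_zero_iff, mul_comm]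
      exact hx'.le
    have hzero : ∀ x ∉ Metric.closedBall (0 : EuclideanSpace ℝ (Fin 3)) (2 * δ),
        ‖fderiv ℝ h x‖ ^ 2 = 0 := fun x hx => by
      simp [fderiv_of_notMem_tsupport (𝕜 := ℝ) (fun hx' => hx (hsupp hx'))]
    rw [← setIntegral_eq_integral_of_forall_compl_eq_zero hzero]
    calc _ ≤ (K * δ⁻¹) ^ 2 *
          volume.real (Metric.closedBall (0 : EuclideanSpace ℝ (Fin 3)) (2 * δ)) := by
          refine (Real.le_norm_self _).trans (norm_setIntegral_le_of_norm_le_const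
            measure_closedBall_lt_top fun x _ => ?_)
          rw [norm_pow, norm_norm]
          gcongr
          exact hK δ hδ hδ1 x
      _ = K ^ 2 * 8 * V * δ := by
          rw [Measure.addHaar_real_closedBall _ _ (by positivity), finrank_euclideanSpace_fin]
          field_simp
          ring
      _ ≤ ε ^ 2 := hδε
end

section
/- Let a < b be real numbers and X a Hausdorff topological space. Suppose φ : ℝ × ([a,b] × X) → [a,b] × X, written (s, (τ, ρ)) ↦ φ_s(τ, ρ), is continuous, preserves the first coordinate (the first component of φ_s(τ, ρ) equals τ for all s, τ, ρ), and for every compact interval [c,d] ⊆ ℝ the restricted map [c,d] × [a,b] × X → [a,b] × X, (s, τ, ρ) ↦ φ_s(τ, ρ), is proper (preimages of compact sets are compact). Let μ be a Borel measure on [a,b] × X which is finite on compact sets, and assume μ is invariant under each φ_s in the sense that ∫ m(φ_s(p)) dμ(p) = ∫ m(p) dμ(p) for every s ∈ ℝ and every continuous compactly supported m : [a,b] × X → ℝ. Let g : [a,b] → ℝ be continuous, and define φ̃_s(τ, ρ) := φ_{s·g(τ)}(τ, ρ). Then μ is also invariant under each φ̃_s: ∫ m(φ̃_s(p)) dμ(p)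 = ∫ m(p) dμ(p) for every s ∈ ℝ and every continuous compactly supported m : [a,b] × X → ℝ. -/
open MeasureTheory

/-- **Lemma B.1 (reparametrization of the flow).** Let `a < b`, `X` Hausdorff, and
`φ_s : [a,b] × X → [a,b] × X` jointly continuous, preserving the first coordinate, and
proper when the parameter `s` is restricted to any compact interval `[c,d]`. If a Borel
measure `μ` on `[a,b] × X`, finite on compact sets, is invariant under every `φ_s`
(tested against continuous compactly supported functions), then `μ` is invariant under
the fiberwise reparametrized flow `φ̃_s(τ, ρ) = φ_{s g(τ)}(τ, ρ)` for any continuous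
`g : [a,b] → ℝ`. -/
theorem stmt3 {X : Type*} [TopologicalSpace X] [T2Space X]
    [MeasurableSpace X] [BorelSpace X]
    (a b : ℝ) (hab : a < b)
    (φ : ℝ → Set.Icc a b × X → Set.Icc a b × X)
    (hcont : Continuous fun p : ℝ × (Set.Icc a b × X) => φ p.1 p.2)
    (hfst : ∀ (s : ℝ) (q : Set.Icc a b × X), (φ s q).1 = q.1)
    (hproper : ∀ c d : ℝ, ∀ K : Set (Set.Icc a b × X), IsCompact K →
      IsCompact {p : ℝ × (Set.Icc a b × X) | p.1 ∈ Set.Icc c d ∧ φ p.1 p.2 ∈ K})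
    (μ : Measure (Set.Icc a b × X))
    (hμfin : ∀ K : Set (Set.Icc a b × X), IsCompact K → μ K < ⊤)
    (hinv : ∀ s : ℝ, ∀ m : Set.Icc a b × X → ℝ, Continuous m → HasCompactSupport m →
      ∫ p, m (φ s p) ∂μ = ∫ p, m p ∂μ)
    (g : Set.Icc a b → ℝ) (hg : Continuous g) :
    ∀ s : ℝ, ∀ m : Set.Icc a b × X → ℝ, Continuous m → HasCompactSupport m →
      ∫ p, m (φ (s * g p.1) p) ∂μ = ∫ p, m p ∂μ := by
  intro s m hm hmc
  have : IsFiniteMeasureOnCompacts μ := ⟨fun K hK => hμfin K hK⟩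
  have hsg : Continuous fun τ => s * g τ := continuous_const.mul hg
  obtain ⟨c, hc⟩ := (isCompact_range hsg).bddBelow
  obtain ⟨d, hd⟩ := (isCompact_range hsg).bddAbove
  have hmem : ∀ τ, s * g τ ∈ Set.Icc c d := fun τ => ⟨hc ⟨τ, rfl⟩, hd ⟨τ, rfl⟩⟩
  set K : Set (Set.Icc a b × X) :=
    Prod.snd '' {p : ℝ × (Set.Icc a b × X) | p.1 ∈ Set.Icc c d ∧ φ p.1 p.2 ∈ tsupport m}
  have hK : IsCompact K := (hproper c d _ hmc).image continuous_snd
  have hzero : ∀ t ∈ Set.Icc c d, ∀ p ∉ K, m (φ t p) = 0 := fun t ht p hp =>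
    image_eq_zero_of_notMem_tsupport fun h => hp ⟨(t, p), ⟨ht, h⟩, rfl⟩
  have hφ : ∀ t, Continuous (φ t) := fun t => hcont.comp (by fun_prop : Continuous fun p => (t, p))
  have hint : ∀ f : Set.Icc a b × X → ℝ, Continuous f → (∀ p ∉ K, f p = 0) → Integrable f μ :=
    fun f hf hf0 => hf.integrable_of_hasCompactSupport (HasCompactSupport.intro hK hf0)
  have hrep : Continuous fun p : Set.Icc a b × X => m (φ (s * g p.1) p) :=
    hm.comp (hcont.comp (by fun_prop : Continuous fun p : Set.Icc a b × X => (s * g p.1, p)))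
  -- The map `τ ↦ m ∘ φ_{s g(τ)}` is continuous for uniform convergence on `K`.
  let γ : C(Set.Icc a b, C(K, ℝ)) := ContinuousMap.curry
    ⟨fun q : Set.Icc a b × K => m (φ (s * g q.1) q.2),
      hm.comp (hcont.comp (by fun_prop :
        Continuous fun q : Set.Icc a b × K => (s * g q.1, (q.2 : Set.Icc a b × X))))⟩
  have : CompactSpace K := isCompact_iff_compactSpace.mp hK
  have key : ∀ ε > 0, ‖∫ p, m (φ (s * g p.1) p) ∂μ - ∫ p, m p ∂μ‖ ≤ ε * μ.real K := by
    intro ε hε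
    let U : Set.Icc a b → Set (Set.Icc a b) := fun τ₀ => γ ⁻¹' Metric.ball (γ τ₀) ε
    have hU : ∀ τ₀, IsOpen (U τ₀) := fun τ₀ => Metric.isOpen_ball.preimage γ.continuous
    obtain ⟨χ, hχ⟩ := PartitionOfUnity.exists_isSubordinate isClosed_univ U hU
      fun τ _ => Set.mem_iUnion.2 ⟨τ, Metric.mem_ball_self hε⟩
    obtain ⟨J, hJ⟩ : ∃ J : Finset (Set.Icc a b), ∀ τ, ∀ j ∉ J, χ j τ = 0 := by
      have hfin := χ.locallyFinite.finite_nonempty_of_compact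
      refine ⟨hfin.toFinset, fun τ j hj => ?_⟩
      by_contra h
      exact hj (hfin.mem_toFinset.2 ⟨τ, h⟩)
    have hsum : ∀ τ, ∑ j ∈ J, χ j τ = 1 := fun τ => by
      rw [← χ.sum_eq_one (Set.mem_univ τ)]
      exact (finsum_eq_sum_of_support_subset _ fun j hj => by
        by_contra h
        exact hj (hJ τ j h)).symm
    have hmχ : ∀ j, Continuous fun p : Set.Icc a b × X => χ j p.1 * m p := fun j => by fun_prop
    have hmχc : ∀ j, HasCompactSupport fun p : Set.Icc a b × X => χ j p.1 * m p :=
      fun j => hmc.mul_left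
    have hterm : ∀ j, Integrable (fun p => χ j p.1 * m (φ (s * g j) p)) μ := fun j =>
      hint _ (by have := hφ (s * g j); fun_prop) fun p hp => by
        rw [hzero _ (hmem j) p hp, mul_zero]
    have happrox : ∫ p, ∑ j ∈ J, χ j p.1 * m (φ (s * g j) p) ∂μ = ∫ p, m p ∂μ := by
      calc
        _ = ∑ j ∈ J, ∫ p, χ j p.1 * m (φ (s * g j) p) ∂μ :=
          integral_finsetSum _ fun j _ => hterm j
        _ = ∑ j ∈ J, ∫ p, χ j p.1 * m p ∂μ := Finset.sum_congr rfl fun j _ => by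
          simpa only [hfst] using hinv (s * g j) _ (hmχ j) (hmχc j)
        _ = ∫ p, ∑ j ∈ J, χ j p.1 * m p ∂μ :=
          (integral_finsetSum _ fun j _ =>
            (hmχ j).integrable_of_hasCompactSupport (hmχc j)).symm
        _ = ∫ p, m p ∂μ := by simp only [← Finset.sum_mul, hsum, one_mul]
    rw [← happrox, ← integral_sub
      (hint _ hrep fun p hp => hzero _ (hmem _) p hp) (integrable_finsetSum _ fun j _ => hterm j),
      ← setIntegral_eq_integral_of_forall_compl_eq_zero (s := K) fun p hp => by
        simp [hzero _ (hmem _) p hp]]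
    refine norm_setIntegral_le_of_norm_le_const (hμfin K hK) fun p hp => ?_
    calc
      _ = ‖∑ j ∈ J, χ j p.1 * (m (φ (s * g p.1) p) - m (φ (s * g j) p))‖ := by
        simp only [mul_sub, Finset.sum_sub_distrib, ← Finset.sum_mul, hsum, one_mul]
      _ ≤ ∑ j ∈ J, χ j p.1 * ε := norm_sum_le_of_le _ fun j _ => by
        rw [norm_mul, Real.norm_of_nonneg (χ.nonneg j _)]
        by_cases h : χ j p.1 = 0
        · simp [h]
        · have hj : dist (γ p.1) (γ j) < ε := hχ j (subset_tsupport _ h)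
          exact mul_le_mul_of_nonneg_left
            ((ContinuousMap.dist_apply_le_dist (f := γ p.1) (g := γ j) ⟨p, hp⟩).trans hj.le)
            (χ.nonneg j _)
      _ = ε := by rw [← Finset.sum_mul, hsum, one_mul]
  have hlim : Filter.Tendsto (fun ε : ℝ => ε * μ.real K) (nhdsWithin 0 (Set.Ioi 0)) (nhds 0) := by
    have h : Continuous fun ε : ℝ => ε * μ.real K := by fun_prop
    simpa using (h.tendsto 0).mono_left nhdsWithin_le_nhds
  exact sub_eq_zero.1 (norm_le_zero_iff.1 (ge_of_tendsto hlim
    (Filter.eventually_of_mem self_mem_nhdsWithin key)))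
end

section
/- Under the billiard-reflection hypotheses below, the following monotonicity inequality holds: ⟨x₁^(N) − x₂^(N), ξ₁^(N) − ξ₂^(N)⟩ ≥ Σ_{k=0}^{N−1} (t₁^(k) + t₂^(k)) · (1 − ⟨ξ₁^(k), ξ₂^(k)⟩). -/
open scoped RealInnerProductSpace

/-- One flight-and-reflection step increases `⟪x₁ - x₂, ξ₁ - ξ₂⟫` by at least
`(s₁ + s₂) * (1 - ⟪ξ₁, ξ₂⟫)`. -/
theorem inner_sub_reflect_step {E : Type*} [NormedAddCommGroup E] [InnerProductSpace ℝ E]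
    {x₁ x₂ y₁ y₂ ξ₁ ξ₂ η₁ η₂ n₁ n₂ : E} {s₁ s₂ : ℝ}
    (hξ₁ : ‖ξ₁‖ = 1) (hξ₂ : ‖ξ₂‖ = 1)
    (hy₁ : y₁ = x₁ + s₁ • ξ₁) (hy₂ : y₂ = x₂ + s₂ • ξ₂)
    (hη₁ : η₁ = ξ₁ - (2 * ⟪ξ₁, n₁⟫) • n₁) (hη₂ : η₂ = ξ₂ - (2 * ⟪ξ₂, n₂⟫) • n₂)
    (hn₁ : 0 ≤ ⟪ξ₁, n₁⟫) (hn₂ : 0 ≤ ⟪ξ₂, n₂⟫)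
    (hc₁ : ⟪y₁ - y₂, n₁⟫ ≤ 0) (hc₂ : ⟪y₂ - y₁, n₂⟫ ≤ 0) :
    ⟪x₁ - x₂, ξ₁ - ξ₂⟫ + (s₁ + s₂) * (1 - ⟪ξ₁, ξ₂⟫) ≤ ⟪y₁ - y₂, η₁ - η₂⟫ := by
  have hflight : ⟪y₁ - y₂, ξ₁ - ξ₂⟫ =
      ⟪x₁ - x₂, ξ₁ - ξ₂⟫ + (s₁ + s₂) * (1 - ⟪ξ₁, ξ₂⟫) := by
    rw [hy₁, hy₂]
    simp only [inner_sub_left, inner_sub_right, inner_add_left, real_inner_smul_left,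
      real_inner_self_eq_norm_sq, hξ₁, hξ₂, real_inner_comm ξ₁ ξ₂]
    ring
  have hreflect : ⟪y₁ - y₂, η₁ - η₂⟫ = ⟪y₁ - y₂, ξ₁ - ξ₂⟫
      - 2 * (⟪ξ₁, n₁⟫ * ⟪y₁ - y₂, n₁⟫) - 2 * (⟪ξ₂, n₂⟫ * ⟪y₂ - y₁, n₂⟫) := by
    rw [hη₁, hη₂]
    simp only [inner_sub_left, inner_sub_right, real_inner_smul_right]
    ring
  linarith [mul_nonpos_of_nonneg_of_nonpos hn₁ hc₁, mul_nonpos_of_nonneg_of_nonpos hn₂ hc₂]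

/-- **Key billiard monotonicity inequality (proof of Lemma 7.1).** For two broken billiard
trajectories issued from the same point and reflecting `N` times on the boundaries of the
same convex obstacles (with inward normals `n_j^{(k)}`), one has
`⟨x₁^{(N)} − x₂^{(N)}, ξ₁^{(N)} − ξ₂^{(N)}⟩ ≥ Σ_{k<N} (t₁^{(k)} + t₂^{(k)})(1 − ⟨ξ₁^{(k)}, ξ₂^{(k)}⟩)`. -/
theorem stmt4 {d : ℕ} (hd : 1 ≤ d) (N : ℕ) (hN : 1 ≤ N)
    (x₁ x₂ ξ₁ ξ₂ n₁ n₂ : ℕ → EuclideanSpace ℝ (Fin d))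
    (t₁ t₂ : ℕ → ℝ)
    (hx0 : x₁ 0 = x₂ 0)
    (hξ₁unit : ∀ k, k ≤ N → ‖ξ₁ k‖ = 1)
    (hξ₂unit : ∀ k, k ≤ N → ‖ξ₂ k‖ = 1)
    (hn₁unit : ∀ k, 1 ≤ k → k ≤ N → ‖n₁ k‖ = 1)
    (hn₂unit : ∀ k, 1 ≤ k → k ≤ N → ‖n₂ k‖ = 1)
    (ht₁ : ∀ k, k < N → 0 ≤ t₁ k)
    (ht₂ : ∀ k, k < N → 0 ≤ t₂ k)
    (hx₁ : ∀ k, k < N → x₁ (k + 1) = x₁ k + t₁ k • ξ₁ k)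
    (hx₂ : ∀ k, k < N → x₂ (k + 1) = x₂ k + t₂ k • ξ₂ k)
    (hξ₁ : ∀ k, k < N → ξ₁ (k + 1) = ξ₁ k - (2 * ⟪ξ₁ k, n₁ (k + 1)⟫) • n₁ (k + 1))
    (hξ₂ : ∀ k, k < N → ξ₂ (k + 1) = ξ₂ k - (2 * ⟪ξ₂ k, n₂ (k + 1)⟫) • n₂ (k + 1))
    (hrefl₁ : ∀ k, k < N → 0 ≤ ⟪ξ₁ k, n₁ (k + 1)⟫)
    (hrefl₂ : ∀ k, k < N → 0 ≤ ⟪ξ₂ k, n₂ (k + 1)⟫)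
    (hconv₁ : ∀ k, 1 ≤ k → k ≤ N → ⟪x₁ k - x₂ k, n₁ k⟫ ≤ 0)
    (hconv₂ : ∀ k, 1 ≤ k → k ≤ N → ⟪x₂ k - x₁ k, n₂ k⟫ ≤ 0) :
    ∑ k ∈ Finset.range N, (t₁ k + t₂ k) * (1 - ⟪ξ₁ k, ξ₂ k⟫)
      ≤ ⟪x₁ N - x₂ N, ξ₁ N - ξ₂ N⟫ := by
  have key : ∀ m, m ≤ N → ∑ k ∈ Finset.range m, (t₁ k + t₂ k) * (1 - ⟪ξ₁ k, ξ₂ k⟫)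
      ≤ ⟪x₁ m - x₂ m, ξ₁ m - ξ₂ m⟫ := by
    intro m
    induction m with
    | zero => simp [hx0]
    | succ m ih =>
      intro hm
      have hlt : m < N := hm
      rw [Finset.sum_range_succ]
      linarith [ih hlt.le, inner_sub_reflect_step (hξ₁unit m hlt.le) (hξ₂unit m hlt.le)
        (hx₁ m hlt) (hx₂ m hlt) (hξ₁ m hlt) (hξ₂ m hlt) (hrefl₁ m hlt) (hrefl₂ m hlt)
        (hconv₁ (m + 1) (by lia) hm) (hconv₂ (m + 1) (by lia) hm)]
  exact key N le_rfl
end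

section
/- Under the billiard-reflection hypotheses below, suppose in addition there exist t₁^(N) ≥ 0 and t₂^(N) ≥ 0 such that x₁^(N) + t₁^(N) ξ₁^(N) = x₂^(N) + t₂^(N) ξ₂^(N), and that t₁^(0) + t₂^(0) > 0. Then ξ₁^(0) = ξ₂^(0): two broken billiard trajectories issued from the same point, following the same story of reflections on the boundaries of the same convex obstacles, and arriving at the same point after the same number of reflections, must have equal initial directions. -/
open scoped RealInnerProductSpace

section Billiard

variable {E : Type*} [NormedAddCommGroup E] [InnerProductSpace ℝ E]

/-- Effect of free flight on the correlation of relative position and relative direction. -/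
lemma inner_freeFlight (x y u v : E) (s t : ℝ) (hu : ‖u‖ = 1) (hv : ‖v‖ = 1) :
    ⟪(x + s • u) - (y + t • v), u - v⟫ = ⟪x - y, u - v⟫ + (s + t) * (1 - ⟪u, v⟫) := by
  have huu : ⟪u, u⟫ = 1 := by rw [real_inner_self_eq_norm_sq, hu]; norm_num
  have hvv : ⟪v, v⟫ = 1 := by rw [real_inner_self_eq_norm_sq, hv]; norm_num
  simp only [inner_sub_left, inner_sub_right, inner_add_left, real_inner_smul_left,
    huu, hvv, real_inner_comm u v]
  ring

/-- Reflection on the boundary of a common convex obstacle does not decrease the correlation of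
relative position and relative direction. -/
lemma inner_le_inner_reflect (z u v m n : E) (hu : 0 ≤ ⟪u, m⟫) (hv : 0 ≤ ⟪v, n⟫)
    (hm : ⟪z, m⟫ ≤ 0) (hn : 0 ≤ ⟪z, n⟫) :
    ⟪z, u - v⟫ ≤ ⟪z, (u - (2 * ⟪u, m⟫) • m) - (v - (2 * ⟪v, n⟫) • n)⟫ := by
  simp only [inner_sub_right, real_inner_smul_right]
  nlinarith [mul_nonneg hu (neg_nonneg.mpr hm), mul_nonneg hv hn]

lemma inner_le_one_of_unit {u v : E} (hu : ‖u‖ = 1) (hv : ‖v‖ = 1) : ⟪u, v⟫ ≤ 1 := by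
  simpa [hu, hv] using real_inner_le_norm u v

end Billiard

/-- **Core of Lemma 7.1 (non-reconcentration).** Two broken billiard trajectories issued
from the same point, following the same story of reflections on the boundaries of the same
convex obstacles, and arriving at the same point after the same number of reflections,
must have equal initial directions. -/
theorem stmt5 {d : ℕ} (hd : 1 ≤ d) (N : ℕ) (hN : 1 ≤ N)
    (x₁ x₂ ξ₁ ξ₂ n₁ n₂ : ℕ → EuclideanSpace ℝ (Fin d))
    (t₁ t₂ : ℕ → ℝ)
    (hx0 : x₁ 0 = x₂ 0)
    (hξ₁unit : ∀ k, k ≤ N → ‖ξ₁ k‖ = 1)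
    (hξ₂unit : ∀ k, k ≤ N → ‖ξ₂ k‖ = 1)
    (hn₁unit : ∀ k, 1 ≤ k → k ≤ N → ‖n₁ k‖ = 1)
    (hn₂unit : ∀ k, 1 ≤ k → k ≤ N → ‖n₂ k‖ = 1)
    (ht₁ : ∀ k, k < N → 0 ≤ t₁ k)
    (ht₂ : ∀ k, k < N → 0 ≤ t₂ k)
    (hx₁ : ∀ k, k < N → x₁ (k + 1) = x₁ k + t₁ k • ξ₁ k)
    (hx₂ : ∀ k, k < N → x₂ (k + 1) = x₂ k + t₂ k • ξ₂ k)
    (hξ₁ : ∀ k, k < N → ξ₁ (k + 1) = ξ₁ k - (2 * ⟪ξ₁ k, n₁ (k + 1)⟫) • n₁ (k + 1))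
    (hξ₂ : ∀ k, k < N → ξ₂ (k + 1) = ξ₂ k - (2 * ⟪ξ₂ k, n₂ (k + 1)⟫) • n₂ (k + 1))
    (hrefl₁ : ∀ k, k < N → 0 ≤ ⟪ξ₁ k, n₁ (k + 1)⟫)
    (hrefl₂ : ∀ k, k < N → 0 ≤ ⟪ξ₂ k, n₂ (k + 1)⟫)
    (hconv₁ : ∀ k, 1 ≤ k → k ≤ N → ⟪x₁ k - x₂ k, n₁ k⟫ ≤ 0)
    (hconv₂ : ∀ k, 1 ≤ k → k ≤ N → ⟪x₂ k - x₁ k, n₂ k⟫ ≤ 0)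
    (T₁ T₂ : ℝ) (hT₁ : 0 ≤ T₁) (hT₂ : 0 ≤ T₂)
    (hend : x₁ N + T₁ • ξ₁ N = x₂ N + T₂ • ξ₂ N)
    (ht0 : 0 < t₁ 0 + t₂ 0) :
    ξ₁ 0 = ξ₂ 0 := by
  have step : ∀ k, k < N → ⟪x₁ k - x₂ k, ξ₁ k - ξ₂ k⟫ + (t₁ k + t₂ k) * (1 - ⟪ξ₁ k, ξ₂ k⟫) ≤
      ⟪x₁ (k + 1) - x₂ (k + 1), ξ₁ (k + 1) - ξ₂ (k + 1)⟫ := by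
    intro k hk
    rw [← inner_freeFlight _ _ _ _ _ _ (hξ₁unit k hk.le) (hξ₂unit k hk.le), ← hx₁ k hk,
      ← hx₂ k hk, hξ₁ k hk, hξ₂ k hk]
    have hn := hconv₂ (k + 1) (by lia) hk
    rw [← neg_sub, inner_neg_left, neg_nonpos] at hn
    exact inner_le_inner_reflect _ _ _ _ _ (hrefl₁ k hk) (hrefl₂ k hk)
      (hconv₁ (k + 1) (by lia) hk) hn
  have lower : ∀ k, 1 ≤ k → k ≤ N → (t₁ 0 + t₂ 0) * (1 - ⟪ξ₁ 0, ξ₂ 0⟫) ≤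
      ⟪x₁ k - x₂ k, ξ₁ k - ξ₂ k⟫ := by
    intro k hk
    induction k, hk using Nat.le_induction with
    | base => intro h; simpa [hx0] using step 0 h
    | succ k hk ih =>
      intro h
      have hflight := mul_nonneg (add_nonneg (ht₁ k h) (ht₂ k h))
        (sub_nonneg.mpr (inner_le_one_of_unit (hξ₁unit k (by lia)) (hξ₂unit k (by lia))))
      linarith [ih (by lia), step k h]
  have final := inner_freeFlight (x₁ N) (x₂ N) (ξ₁ N) (ξ₂ N) T₁ T₂
    (hξ₁unit N le_rfl) (hξ₂unit N le_rfl)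
  rw [hend, sub_self, inner_zero_left] at final
  have hflight := mul_nonneg (add_nonneg hT₁ hT₂)
    (sub_nonneg.mpr (inner_le_one_of_unit (hξ₁unit N le_rfl) (hξ₂unit N le_rfl)))
  have hnonpos : (t₁ 0 + t₂ 0) * (1 - ⟪ξ₁ 0, ξ₂ 0⟫) ≤ 0 := by linarith [lower N hN le_rfl]
  have hle := nonpos_of_mul_nonpos_right hnonpos ht0
  have h₁ := hξ₁unit 0 N.zero_le
  have h₂ := hξ₂unit 0 N.zero_le
  exact (inner_eq_one_iff_of_norm_eq_one h₁ h₂).mp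
    (le_antisymm (inner_le_one_of_unit h₁ h₂) (by linarith))
end

section
/- Under the infinite billiard-reflection hypotheses below, suppose the sequence (x₁^(k) − x₂^(k))_{k∈ℕ} is bounded in ℝ^d, that ξ₁^(k) − ξ₂^(k) → 0 as k → ∞, and that t₁^(0) + t₂^(0) > 0. Then ξ₁^(0) = ξ₂^(0). -/
open Filter
open scoped RealInnerProductSpace Topology

/-- **Core of Lemma 7.2 (weak trapping).** For two infinite broken billiard trajectories
issued from the same point and reflecting forever on the boundaries of the same convex
obstacles, if the differences of the reflection points stay bounded and the differences of
the directions tend to zero, then the initial directions coincide. -/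
theorem stmt6 {d : ℕ} (hd : 1 ≤ d)
    (x₁ x₂ ξ₁ ξ₂ n₁ n₂ : ℕ → EuclideanSpace ℝ (Fin d))
    (t₁ t₂ : ℕ → ℝ)
    (hx0 : x₁ 0 = x₂ 0)
    (hξ₁unit : ∀ k, ‖ξ₁ k‖ = 1)
    (hξ₂unit : ∀ k, ‖ξ₂ k‖ = 1)
    (hn₁unit : ∀ k, 1 ≤ k → ‖n₁ k‖ = 1)
    (hn₂unit : ∀ k, 1 ≤ k → ‖n₂ k‖ = 1)
    (ht₁ : ∀ k, 0 ≤ t₁ k)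
    (ht₂ : ∀ k, 0 ≤ t₂ k)
    (hx₁ : ∀ k, x₁ (k + 1) = x₁ k + t₁ k • ξ₁ k)
    (hx₂ : ∀ k, x₂ (k + 1) = x₂ k + t₂ k • ξ₂ k)
    (hξ₁ : ∀ k, ξ₁ (k + 1) = ξ₁ k - (2 * ⟪ξ₁ k, n₁ (k + 1)⟫) • n₁ (k + 1))
    (hξ₂ : ∀ k, ξ₂ (k + 1) = ξ₂ k - (2 * ⟪ξ₂ k, n₂ (k + 1)⟫) • n₂ (k + 1))
    (hrefl₁ : ∀ k, 0 ≤ ⟪ξ₁ k, n₁ (k + 1)⟫)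
    (hrefl₂ : ∀ k, 0 ≤ ⟪ξ₂ k, n₂ (k + 1)⟫)
    (hconv₁ : ∀ k, 1 ≤ k → ⟪x₁ k - x₂ k, n₁ k⟫ ≤ 0)
    (hconv₂ : ∀ k, 1 ≤ k → ⟪x₂ k - x₁ k, n₂ k⟫ ≤ 0)
    (hbdd : ∃ C : ℝ, ∀ k, ‖x₁ k - x₂ k‖ ≤ C)
    (hdir : Tendsto (fun k => ξ₁ k - ξ₂ k) atTop (𝓝 0))
    (ht0 : 0 < t₁ 0 + t₂ 0) :
    ξ₁ 0 = ξ₂ 0 := by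
  have step : ∀ k, ⟪x₁ k - x₂ k, ξ₁ k - ξ₂ k⟫ + (t₁ k + t₂ k) * (1 - ⟪ξ₁ k, ξ₂ k⟫)
      ≤ ⟪x₁ (k + 1) - x₂ (k + 1), ξ₁ (k + 1) - ξ₂ (k + 1)⟫ := by
    intro k
    have free : ⟪x₁ (k + 1) - x₂ (k + 1), ξ₁ k - ξ₂ k⟫
        = ⟪x₁ k - x₂ k, ξ₁ k - ξ₂ k⟫ + (t₁ k + t₂ k) * (1 - ⟪ξ₁ k, ξ₂ k⟫) := by
      rw [hx₁ k, hx₂ k]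
      simp only [inner_sub_left, inner_sub_right, inner_add_left, real_inner_smul_left,
        real_inner_self_eq_norm_sq, hξ₁unit, hξ₂unit, real_inner_comm (ξ₁ k) (ξ₂ k)]
      ring
    have refl : ⟪x₁ (k + 1) - x₂ (k + 1), ξ₁ (k + 1) - ξ₂ (k + 1)⟫
        = ⟪x₁ (k + 1) - x₂ (k + 1), ξ₁ k - ξ₂ k⟫
          - 2 * (⟪ξ₁ k, n₁ (k + 1)⟫ * ⟪x₁ (k + 1) - x₂ (k + 1), n₁ (k + 1)⟫)
          - 2 * (⟪ξ₂ k, n₂ (k + 1)⟫ * ⟪x₂ (k + 1) - x₁ (k + 1), n₂ (k + 1)⟫) := by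
      rw [hξ₁ k, hξ₂ k]
      simp only [inner_sub_left (x₁ (k + 1)), inner_sub_left (x₂ (k + 1)), inner_sub_right,
        real_inner_smul_right]
      ring
    have h₁ := mul_nonpos_of_nonneg_of_nonpos (hrefl₁ k) (hconv₁ (k + 1) k.succ_pos)
    have h₂ := mul_nonpos_of_nonneg_of_nonpos (hrefl₂ k) (hconv₂ (k + 1) k.succ_pos)
    linarith
  have inner_le : ∀ k, ⟪ξ₁ k, ξ₂ k⟫ ≤ 1 := fun k => by
    simpa [hξ₁unit, hξ₂unit] using real_inner_le_norm (ξ₁ k) (ξ₂ k)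
  have mono : Monotone fun k => ⟪x₁ k - x₂ k, ξ₁ k - ξ₂ k⟫ := monotone_nat_of_le_succ fun k =>
    (le_add_of_nonneg_right
      (mul_nonneg (add_nonneg (ht₁ k) (ht₂ k)) (sub_nonneg.2 (inner_le k)))).trans (step k)
  obtain ⟨C, hC⟩ := hbdd
  have lim : Tendsto (fun k => ⟪x₁ k - x₂ k, ξ₁ k - ξ₂ k⟫) atTop (𝓝 0) := by
    refine squeeze_zero_norm (a := fun k => C * ‖ξ₁ k - ξ₂ k‖) (fun k => ?_) ?_
    · exact (norm_inner_le_norm _ _).trans (by gcongr; exact hC k)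
    · simpa using hdir.norm.const_mul C
  have h₁ := mono.ge_of_tendsto lim 1
  have h₀ := step 0
  simp only [zero_add, hx0, sub_self, inner_zero_left] at h₀
  have : ⟪ξ₁ 0, ξ₂ 0⟫ = 1 := by
    refine le_antisymm (inner_le 0) (sub_nonpos.1 ?_)
    exact nonpos_of_mul_nonpos_right (h₀.trans h₁) ht0
  exact (inner_eq_one_iff_of_norm_eq_one (hξ₁unit 0) (hξ₂unit 0)).1 this
end

section
/- Let E be a real inner product space, let u, v ∈ E be unit vectors, and let α > 0, β > 0. Then for every ξ ∈ E, (α + β)·‖ξ‖² − α·⟨ξ, u⟩² − β·⟨ξ, v⟩² ≥ (αβ/(α + β))·(1 − ⟨u, v⟩²)·‖ξ‖². -/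
open scoped RealInnerProductSpace

/-- **Coercivity of the Morawetz Hessian (estimate (eq:d2xi2)–(eq:contrang) in the proof of
Theorem 6.1).** For unit vectors `u, v` of a real inner product space and `α, β > 0`,
`(α + β)‖ξ‖² − α⟨ξ,u⟩² − β⟨ξ,v⟩² ≥ (αβ/(α+β))(1 − ⟨u,v⟩²)‖ξ‖²` for all `ξ`. -/
theorem stmt8 {E : Type*} [NormedAddCommGroup E] [InnerProductSpace ℝ E]
    (u v : E) (hu : ‖u‖ = 1) (hv : ‖v‖ = 1)
    (α β : ℝ) (hα : 0 < α) (hβ : 0 < β) (ξ : E) :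
    α * β / (α + β) * (1 - ⟪u, v⟫ ^ 2) * ‖ξ‖ ^ 2 ≤
      (α + β) * ‖ξ‖ ^ 2 - α * ⟪ξ, u⟫ ^ 2 - β * ⟪ξ, v⟫ ^ 2 := by
  -- Cauchy–Schwarz for `ξ` against its image under `α u ⊗ u + β v ⊗ v`.
  have hCS : (α * ⟪ξ, u⟫ ^ 2 + β * ⟪ξ, v⟫ ^ 2) ^ 2 ≤
      ‖ξ‖ ^ 2 * (α ^ 2 * ⟪ξ, u⟫ ^ 2 + β ^ 2 * ⟪ξ, v⟫ ^ 2 +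
        2 * α * β * ⟪ξ, u⟫ * ⟪ξ, v⟫ * ⟪u, v⟫) := by
    have h := real_inner_mul_inner_self_le ξ ((α * ⟪ξ, u⟫) • u + (β * ⟪ξ, v⟫) • v)
    simp only [inner_add_left, inner_add_right, real_inner_smul_left, real_inner_smul_right,
      real_inner_self_eq_norm_sq, norm_smul, mul_pow, Real.norm_eq_abs, sq_abs, hu, hv,
      real_inner_comm u v] at h
    linarith
  generalize ⟪u, v⟫ = c at *
  generalize ⟪ξ, u⟫ = a at *
  generalize ⟪ξ, v⟫ = b at *
  have hN : 0 ≤ ‖ξ‖ ^ 2 := sq_nonneg _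
  generalize ‖ξ‖ ^ 2 = N at *
  have hs : 0 < α + β := add_pos hα hβ
  have hαβ : 0 < α * β := mul_pos hα hβ
  have hG : (1 - c ^ 2) * (α * a ^ 2 + β * b ^ 2) ≤ (α + β) * (a ^ 2 + b ^ 2 - 2 * a * b * c) := by
    nlinarith [mul_nonneg hα.le (sq_nonneg (b - a * c)), mul_nonneg hβ.le (sq_nonneg (a - b * c))]
  have hd : 0 ≤ (α + β) ^ 2 - α * β * (1 - c ^ 2) := by
    nlinarith [mul_nonneg hαβ.le (sq_nonneg c), sq_nonneg α, sq_nonneg β]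
  have hQ : 0 ≤ α * a ^ 2 + β * b ^ 2 := by positivity
  have key : (α + β) * (α * a ^ 2 + β * b ^ 2) ≤ ((α + β) ^ 2 - α * β * (1 - c ^ 2)) * N := by
    rcases hQ.eq_or_lt with h | h
    · rw [← h, mul_zero]
      exact mul_nonneg hd hN
    · refine le_of_mul_le_mul_right ?_ h
      have h₁ := mul_le_mul_of_nonneg_left hCS hs.le
      have h₂ := mul_le_mul_of_nonneg_left hG (mul_nonneg hN hαβ.le)
      linarith
  have hdiv : α * β / (α + β) * (1 - c ^ 2) * N = α * β * (1 - c ^ 2) * N / (α + β) := by ring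
  rw [hdiv, div_le_iff₀ hs]
  linarith
end

section
/- Let U, V : ℝ × ℝ³ → ℝ be measurable functions with N(U) < ∞ and N(V) < ∞. Let (t_n) be a sequence of real numbers and (x_n) a sequence in ℝ³ with |t_n| + ‖x_n‖ → ∞. Then ∫_ℝ ( ∫_{ℝ³} |U(t, x)|⁸ · |V(t − t_n, x − x_n)|² dx )^{1/2} dt → 0 as n → ∞. -/
open MeasureTheory Filter
open scoped Topology ENNReal

/-- `N(U) = ∫_ℝ (∫_{ℝ³} |U(t,x)|¹⁰ dx)^{1/2} dt`, the fifth power of the mixed Lebesgue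
norm `‖U‖_{L⁵_t L¹⁰_x}`. -/
noncomputable def mixedNorm510 (U : ℝ × EuclideanSpace ℝ (Fin 3) → ℝ) : ℝ≥0∞ :=
  ∫⁻ t : ℝ, (∫⁻ x : EuclideanSpace ℝ (Fin 3), ENNReal.ofReal (|U (t, x)| ^ 10)) ^ ((1 : ℝ) / 2)

/-- The functional `F ↦ ∫ (∫ F(t,x) dx)^{1/2} dt` on nonnegative functions. -/
noncomputable def lintegralSqrt {E : Type*} [MeasureSpace E] (F : ℝ × E → ℝ≥0∞) : ℝ≥0∞ :=
  ∫⁻ t : ℝ, (∫⁻ x : E, F (t, x)) ^ ((1 : ℝ) / 2)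

section LintegralSqrt

variable {E : Type*} [MeasureSpace E]

theorem lintegralSqrt_mono {F G : ℝ × E → ℝ≥0∞} (h : F ≤ G) :
    lintegralSqrt F ≤ lintegralSqrt G :=
  lintegral_mono fun t =>
    ENNReal.rpow_le_rpow (lintegral_mono fun x => h (t, x)) (by norm_num)

variable [SFinite (volume : Measure E)]

theorem Measurable.lintegral_section_rpow_half {F : ℝ × E → ℝ≥0∞} (hF : Measurable F) :
    Measurable fun t => (∫⁻ x : E, F (t, x)) ^ ((1 : ℝ) / 2) :=
  hF.lintegral_prod_right'.pow_const _

theorem lintegralSqrt_add_le {F G : ℝ × E → ℝ≥0∞} (hF : Measurable F) :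
    lintegralSqrt (F + G) ≤ lintegralSqrt F + lintegralSqrt G := by
  unfold lintegralSqrt
  rw [← lintegral_add_left hF.lintegral_section_rpow_half]
  refine lintegral_mono fun t => ?_
  simp only [Pi.add_apply]
  rw [lintegral_add_left (f := fun x => F (t, x)) (hF.comp measurable_prodMk_left)]
  exact ENNReal.rpow_add_le_add_rpow _ _ (by norm_num) (by norm_num)

/-- Hölder's inequality for the functional `lintegralSqrt`. -/
theorem lintegralSqrt_mul_rpow_le {F G : ℝ × E → ℝ≥0∞} (hF : Measurable F) (hG : Measurable G)
    {p q : ℝ} (hp : 0 ≤ p) (hq : 0 ≤ q) (hpq : p + q = 1) :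
    lintegralSqrt (fun z => F z ^ p * G z ^ q) ≤ lintegralSqrt F ^ p * lintegralSqrt G ^ q := by
  refine le_trans (lintegral_mono fun t => ?_)
    (ENNReal.lintegral_mul_norm_pow_le hF.lintegral_section_rpow_half.aemeasurable
      hG.lintegral_section_rpow_half.aemeasurable hp hq hpq)
  calc (∫⁻ x, F (t, x) ^ p * G (t, x) ^ q) ^ ((1 : ℝ) / 2)
      ≤ ((∫⁻ x, F (t, x)) ^ p * (∫⁻ x, G (t, x)) ^ q) ^ ((1 : ℝ) / 2) :=
        ENNReal.rpow_le_rpow (ENNReal.lintegral_mul_norm_pow_le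
          (hF.comp measurable_prodMk_left).aemeasurable
          (hG.comp measurable_prodMk_left).aemeasurable hp hq hpq) (by norm_num)
    _ = _ := by
        rw [ENNReal.mul_rpow_of_nonneg _ _ (by norm_num)]
        simp only [← ENNReal.rpow_mul, mul_comm]

/-- Dominated convergence to zero for the functional `lintegralSqrt`. -/
theorem tendsto_lintegralSqrt_zero {F : ℝ × E → ℝ≥0∞} (hF : Measurable F)
    (hfin : lintegralSqrt F ≠ ⊤) {f : ℕ → ℝ × E → ℝ≥0∞} (hf : ∀ k, Measurable (f k))
    (hle : ∀ k, f k ≤ F) (hlim : ∀ z, Tendsto (fun k => f k z) atTop (𝓝 0)) :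
    Tendsto (fun k => lintegralSqrt (f k)) atTop (𝓝 0) := by
  have key : Tendsto (fun k => lintegralSqrt (f k)) atTop (𝓝 (∫⁻ _ : ℝ, 0)) := by
    refine tendsto_lintegral_of_dominated_convergence _
      (fun k => (hf k).lintegral_section_rpow_half)
      (fun k => Eventually.of_forall fun t =>
        ENNReal.rpow_le_rpow (lintegral_mono fun x => hle k (t, x)) (by norm_num)) hfin ?_
    filter_upwards [ae_lt_top hF.lintegral_section_rpow_half hfin] with t ht
    have hsec : ∫⁻ x : E, F (t, x) ≠ ⊤ := by
      intro h
      rw [h, ENNReal.top_rpow_of_pos (by norm_num)] at ht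
      exact lt_irrefl _ ht
    have h0 : Tendsto (fun k => ∫⁻ x : E, f k (t, x)) atTop (𝓝 (∫⁻ _ : E, 0)) :=
      tendsto_lintegral_of_dominated_convergence _
        (fun k => (hf k).comp measurable_prodMk_left)
        (fun k => Eventually.of_forall fun x => hle k (t, x)) hsec
        (Eventually.of_forall fun x => hlim (t, x))
    simpa using h0.ennrpow_const ((1 : ℝ) / 2)
  simpa using key

end LintegralSqrt

section Translation

variable {E : Type*} [NormedAddCommGroup E] [MeasureSpace E] [BorelSpace E]

theorem lintegralSqrt_comp_sub [(volume : Measure E).IsAddRightInvariant]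
    (G : ℝ × E → ℝ≥0∞) (a : ℝ × E) :
    lintegralSqrt (fun z => G (z - a)) = lintegralSqrt G := by
  unfold lintegralSqrt
  rw [← lintegral_sub_right_eq_self (fun t : ℝ => (∫⁻ x : E, G (t, x)) ^ ((1 : ℝ) / 2)) a.1]
  refine lintegral_congr fun t => ?_
  rw [← lintegral_sub_right_eq_self (fun x : E => G (t - a.1, x)) a.2]
  rfl

variable [SecondCountableTopology E] [SFinite (volume : Measure E)]

theorem tendsto_lintegralSqrt_indicator_norm_ge {F : ℝ × E → ℝ≥0∞} (hF : Measurable F)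
    (hfin : lintegralSqrt F ≠ ⊤) :
    Tendsto (fun k : ℕ => lintegralSqrt ({z : ℝ × E | (k : ℝ) ≤ ‖z‖}.indicator F))
      atTop (𝓝 0) := by
  refine tendsto_lintegralSqrt_zero hF hfin
    (fun k => hF.indicator (measurableSet_le measurable_const measurable_norm))
    (fun k => Set.indicator_le_self _ _) fun z => ?_
  refine tendsto_const_nhds.congr' ?_
  filter_upwards [tendsto_natCast_atTop_atTop.eventually_gt_atTop ‖z‖] with k hk
  have hz : z ∉ {z : ℝ × E | (k : ℝ) ≤ ‖z‖} := not_le.mpr hk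
  exact (Set.indicator_of_notMem hz F).symm

/-- Mixed terms decouple under translations escaping to infinity. -/
theorem tendsto_lintegralSqrt_mul_rpow_comp_sub [(volume : Measure E).IsAddRightInvariant]
    {F G : ℝ × E → ℝ≥0∞} (hF : Measurable F) (hG : Measurable G)
    (hFfin : lintegralSqrt F ≠ ⊤) (hGfin : lintegralSqrt G ≠ ⊤)
    {p q : ℝ} (hp : 0 < p) (hq : 0 < q) (hpq : p + q = 1)
    {a : ℕ → ℝ × E} (ha : Tendsto (fun n => ‖a n‖) atTop atTop) :
    Tendsto (fun n => lintegralSqrt (fun z => F z ^ p * G (z - a n) ^ q)) atTop (𝓝 0) := by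
  let S : ℕ → Set (ℝ × E) := fun k => {z | (k : ℝ) ≤ ‖z‖}
  have hS (k : ℕ) : MeasurableSet (S k) := measurableSet_le measurable_const measurable_norm
  have hbound : Tendsto (fun k =>
      lintegralSqrt ((S k).indicator F) ^ p * lintegralSqrt G ^ q +
        lintegralSqrt F ^ p * lintegralSqrt ((S k).indicator G) ^ q) atTop (𝓝 0) := by
    have h1 := (tendsto_lintegralSqrt_indicator_norm_ge hF hFfin).ennrpow_const p
    have h2 := (tendsto_lintegralSqrt_indicator_norm_ge hG hGfin).ennrpow_const q
    rw [ENNReal.zero_rpow_of_pos hp] at h1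
    rw [ENNReal.zero_rpow_of_pos hq] at h2
    have h3 := ENNReal.Tendsto.mul_const (b := lintegralSqrt G ^ q) h1
      (Or.inr (ENNReal.rpow_ne_top_of_nonneg hq.le hGfin))
    have h4 := ENNReal.Tendsto.const_mul (a := lintegralSqrt F ^ p) h2
      (Or.inr (ENNReal.rpow_ne_top_of_nonneg hp.le hFfin))
    simpa using h3.add h4
  rw [ENNReal.tendsto_nhds_zero]
  intro ε hε
  obtain ⟨k, hk⟩ := (hbound.eventually_le_const hε).exists
  filter_upwards [ha.eventually_ge_atTop (2 * (k : ℝ))] with n hn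
  refine le_trans ?_ hk
  have hsub : Measurable fun z : ℝ × E => z - a n := measurable_id.sub_const _
  have hFS := hF.indicator (hS k)
  have hGS := hG.indicator (hS k)
  have hsplit : (fun z => F z ^ p * G (z - a n) ^ q) ≤
      (fun z => (S k).indicator F z ^ p * G (z - a n) ^ q) +
        fun z => F z ^ p * (S k).indicator G (z - a n) ^ q := by
    intro z
    by_cases hz : z ∈ S k
    · simp [hz]
    · have hz' : z - a n ∈ S k := by
        have h1 : ‖z‖ < k := not_le.mp hz
        have h2 : ‖a n‖ ≤ ‖z‖ + ‖z - a n‖ := by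
          simpa using norm_sub_le z (z - a n)
        change (k : ℝ) ≤ ‖z - a n‖
        linarith
      simp [hz']
  refine (lintegralSqrt_mono hsplit).trans
    ((lintegralSqrt_add_le ((hFS.pow_const p).mul ((hG.comp hsub).pow_const q))).trans ?_)
  gcongr
  · refine (lintegralSqrt_mul_rpow_le hFS (hG.comp hsub) hp.le hq.le hpq).trans_eq ?_
    exact congrArg (_ * · ^ q) (lintegralSqrt_comp_sub G (a n))
  · refine (lintegralSqrt_mul_rpow_le hF (hGS.comp hsub) hp.le hq.le hpq).trans_eq ?_
    exact congrArg (_ * · ^ q) (lintegralSqrt_comp_sub ((S k).indicator G) (a n))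

end Translation

theorem ENNReal.ofReal_pow_eight_mul_sq {a b : ℝ} (ha : 0 ≤ a) (hb : 0 ≤ b) :
    ENNReal.ofReal (a ^ 8 * b ^ 2) =
      ENNReal.ofReal (a ^ 10) ^ ((4 : ℝ) / 5) * ENNReal.ofReal (b ^ 10) ^ ((1 : ℝ) / 5) := by
  rw [ENNReal.ofReal_mul (by positivity), ENNReal.ofReal_rpow_of_nonneg (by positivity)
    (by norm_num), ENNReal.ofReal_rpow_of_nonneg (by positivity) (by norm_num)]
  simp only [← Real.rpow_natCast, ← Real.rpow_mul ha, ← Real.rpow_mul hb]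
  norm_num

/-- **Translation case of the mixed-term orthogonality decay (cases (A.2)–(A.3) of
Lemma 6.2).** For `U, V` with finite `L⁵_t L¹⁰_x` norm and `|t_n| + ‖x_n‖ → ∞`,
`∫_ℝ (∫_{ℝ³} |U(t,x)|⁸ |V(t − t_n, x − x_n)|² dx)^{1/2} dt → 0`. -/
theorem stmt10 (U V : ℝ × EuclideanSpace ℝ (Fin 3) → ℝ)
    (hU : Measurable U) (hV : Measurable V)
    (hNU : mixedNorm510 U < ⊤) (hNV : mixedNorm510 V < ⊤)
    (tseq : ℕ → ℝ) (xseq : ℕ → EuclideanSpace ℝ (Fin 3))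
    (hdiv : Tendsto (fun n => |tseq n| + ‖xseq n‖) atTop atTop) :
    Tendsto (fun n =>
        ∫⁻ t : ℝ, (∫⁻ x : EuclideanSpace ℝ (Fin 3),
          ENNReal.ofReal (|U (t, x)| ^ 8 * |V (t - tseq n, x - xseq n)| ^ 2)) ^ ((1 : ℝ) / 2))
      atTop (𝓝 0) := by
  have hmeas {W : ℝ × EuclideanSpace ℝ (Fin 3) → ℝ} (hW : Measurable W) :
      Measurable fun z => ENNReal.ofReal (|W z| ^ 10) :=
    (hW.abs.pow_const 10).ennreal_ofReal
  have ha : Tendsto (fun n => ‖(tseq n, xseq n)‖) atTop atTop := by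
    refine tendsto_atTop_mono (fun n => ?_) (hdiv.atTop_div_const (two_pos (α := ℝ)))
    have h1 := norm_fst_le (tseq n, xseq n)
    have h2 := norm_snd_le (tseq n, xseq n)
    rw [Real.norm_eq_abs] at h1
    linarith
  have h := tendsto_lintegralSqrt_mul_rpow_comp_sub (hmeas hU) (hmeas hV) hNU.ne hNV.ne
    (p := 4 / 5) (q := 1 / 5) (by norm_num) (by norm_num) (by norm_num) ha
  simpa only [lintegralSqrt, ← ENNReal.ofReal_pow_eight_mul_sq (abs_nonneg _) (abs_nonneg _),
    Prod.mk_sub_mk] using h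
end

section
/- Let U, V : ℝ × ℝ³ → ℝ be measurable functions with N(U) < ∞ and N(V) < ∞. Let (λ_n) be positive reals with λ_n → 0 or λ_n → ∞, and let (t_n), (x_n) be arbitrary sequences in ℝ and ℝ³ respectively. Then ∫_ℝ ( ∫_{ℝ³} |U(t, x)|⁸ · λ_n^{-1} · |V((t − t_n)/λ_n, (x − x_n)/λ_n)|² dx )^{1/2} dt → 0 as n → ∞. -/
open MeasureTheory Filter
open scoped Topology ENNReal

/-- The functional `∫ (∫ f¹⁰ dx)^{1/2} dt` on nonnegative functions of space-time. -/
noncomputable def lmixedNorm (f : ℝ × EuclideanSpace ℝ (Fin 3) → ℝ≥0∞) : ℝ≥0∞ :=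
  ∫⁻ t, (∫⁻ x, f (t, x) ^ 10) ^ ((1 : ℝ) / 2)

/-- The mixed term `∫ (∫ f⁸ g² dx)^{1/2} dt` for nonnegative functions of space-time. -/
noncomputable def lmixedForm (f g : ℝ × EuclideanSpace ℝ (Fin 3) → ℝ≥0∞) : ℝ≥0∞ :=
  ∫⁻ t, (∫⁻ x, f (t, x) ^ 8 * g (t, x) ^ 2) ^ ((1 : ℝ) / 2)

/-- The change of variables `(t, x) ↦ ((t - s) / c, (x - y) / c)`. -/
noncomputable def rescaleMap (c s : ℝ) (y : EuclideanSpace ℝ (Fin 3)) :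
    ℝ × EuclideanSpace ℝ (Fin 3) → ℝ × EuclideanSpace ℝ (Fin 3) :=
  fun p => ((p.1 - s) / c, c⁻¹ • (p.2 - y))

/-- The rescaled function `c^{-1/2} g((t - s) / c, (x - y) / c)`. -/
noncomputable def rescale (c s : ℝ) (y : EuclideanSpace ℝ (Fin 3))
    (g : ℝ × EuclideanSpace ℝ (Fin 3) → ℝ≥0∞) : ℝ × EuclideanSpace ℝ (Fin 3) → ℝ≥0∞ :=
  fun p => ENNReal.ofReal √c⁻¹ * g (rescaleMap c s y p)

/-- The points of the closed ball of radius `k` where `f` is at most `k`. -/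
def truncationSet (f : ℝ × EuclideanSpace ℝ (Fin 3) → ℝ≥0∞) (k : ℕ) :
    Set (ℝ × EuclideanSpace ℝ (Fin 3)) :=
  {p | ‖p‖ ≤ k ∧ f p ≤ k}

lemma measurable_rescaleMap (c s : ℝ) (y : EuclideanSpace ℝ (Fin 3)) :
    Measurable (rescaleMap c s y) := by
  unfold rescaleMap
  fun_prop

lemma Measurable.rescale {g : ℝ × EuclideanSpace ℝ (Fin 3) → ℝ≥0∞} (hg : Measurable g)
    (c s : ℝ) (y : EuclideanSpace ℝ (Fin 3)) : Measurable (rescale c s y g) :=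
  (hg.comp (measurable_rescaleMap c s y)).const_mul _

lemma measurableSet_truncationSet {f : ℝ × EuclideanSpace ℝ (Fin 3) → ℝ≥0∞}
    (hf : Measurable f) (k : ℕ) : MeasurableSet (truncationSet f k) :=
  (measurableSet_le measurable_norm measurable_const).inter
    (measurableSet_le hf measurable_const)

lemma eventually_mem_truncationSet {f : ℝ × EuclideanSpace ℝ (Fin 3) → ℝ≥0∞}
    {p : ℝ × EuclideanSpace ℝ (Fin 3)} (hp : f p ≠ ∞) :
    ∀ᶠ k in atTop, p ∈ truncationSet f k := by
  obtain ⟨m, hm⟩ := exists_nat_ge ‖p‖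
  obtain ⟨n, hn⟩ := ENNReal.exists_nat_gt hp
  filter_upwards [eventually_ge_atTop m, eventually_ge_atTop n] with k hmk hnk
  exact ⟨hm.trans (by exact_mod_cast hmk), hn.le.trans (by exact_mod_cast hnk)⟩

lemma measurable_lintegral_rpow_half {h : ℝ × EuclideanSpace ℝ (Fin 3) → ℝ≥0∞}
    (hh : Measurable h) : Measurable fun t => (∫⁻ x, h (t, x)) ^ ((1 : ℝ) / 2) :=
  hh.lintegral_prod_right'.pow_const _

/-- Hölder's inequality for the mixed term. -/
lemma lmixedForm_le {f g : ℝ × EuclideanSpace ℝ (Fin 3) → ℝ≥0∞}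
    (hf : Measurable f) (hg : Measurable g) :
    lmixedForm f g ≤ lmixedNorm f ^ ((4 : ℝ) / 5) * lmixedNorm g ^ ((1 : ℝ) / 5) := by
  have hf10 : Measurable fun p => f p ^ 10 := hf.pow_const 10
  have hg10 : Measurable fun p => g p ^ 10 := hg.pow_const 10
  refine le_trans (lintegral_mono fun t => ?_)
    (ENNReal.lintegral_mul_norm_pow_le (measurable_lintegral_rpow_half hf10).aemeasurable
      (measurable_lintegral_rpow_half hg10).aemeasurable
      (by norm_num) (by norm_num) (by norm_num))
  have key : ∫⁻ x, f (t, x) ^ 8 * g (t, x) ^ 2 ≤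
      (∫⁻ x, f (t, x) ^ 10) ^ ((4 : ℝ) / 5) * (∫⁻ x, g (t, x) ^ 10) ^ ((1 : ℝ) / 5) := by
    refine le_trans (lintegral_mono fun x => le_of_eq ?_)
      (ENNReal.lintegral_mul_norm_pow_le
        (hf10.comp measurable_prodMk_left).aemeasurable
        (hg10.comp measurable_prodMk_left).aemeasurable
        (by norm_num) (by norm_num) (by norm_num))
    simp only [Function.comp_apply, ← ENNReal.rpow_natCast, ← ENNReal.rpow_mul]
    norm_num
  refine (ENNReal.rpow_le_rpow key (by norm_num)).trans (le_of_eq ?_)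
  rw [ENNReal.mul_rpow_of_nonneg _ _ (by norm_num)]
  simp only [← ENNReal.rpow_mul]
  norm_num

lemma lintegral_comp_inv_smul_sub {E : Type*} [NormedAddCommGroup E] [NormedSpace ℝ E]
    [FiniteDimensional ℝ E] [MeasurableSpace E] [BorelSpace E] (μ : Measure E)
    [μ.IsAddHaarMeasure] {h : E → ℝ≥0∞} (hh : Measurable h) {c : ℝ} (hc : 0 < c) (y : E) :
    ∫⁻ x, h (c⁻¹ • (x - y)) ∂μ =
      ENNReal.ofReal (c ^ Module.finrank ℝ E) * ∫⁻ x, h x ∂μ := by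
  rw [lintegral_sub_right_eq_self (fun x => h (c⁻¹ • x)) y,
    ← lintegral_map hh (measurable_const_smul c⁻¹),
    Measure.map_addHaar_smul μ (inv_ne_zero hc.ne'), lintegral_smul_measure, inv_pow, inv_inv,
    abs_of_nonneg (by positivity), smul_eq_mul]

lemma ofReal_sqrt_pow {a : ℝ} (ha : 0 ≤ a) (m : ℕ) :
    ENNReal.ofReal √a ^ (2 * m) = ENNReal.ofReal (a ^ m) := by
  rw [← ENNReal.ofReal_pow (Real.sqrt_nonneg _), pow_mul, Real.sq_sqrt ha]

/-- Scaling invariance. -/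
lemma lmixedNorm_rescale {g : ℝ × EuclideanSpace ℝ (Fin 3) → ℝ≥0∞} (hg : Measurable g)
    {c : ℝ} (hc : 0 < c) (s : ℝ) (y : EuclideanSpace ℝ (Fin 3)) :
    lmixedNorm (rescale c s y g) = lmixedNorm g := by
  have hg10 : Measurable fun p => g p ^ 10 := hg.pow_const 10
  have inner (t : ℝ) : (∫⁻ x, rescale c s y g (t, x) ^ 10) ^ ((1 : ℝ) / 2) =
      ENNReal.ofReal c⁻¹ * (∫⁻ x, g (c⁻¹ • (t - s), x) ^ 10) ^ ((1 : ℝ) / 2) := by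
    have h1 := lintegral_comp_inv_smul_sub (volume : Measure (EuclideanSpace ℝ (Fin 3)))
      (hg10.comp (measurable_prodMk_left (x := c⁻¹ • (t - s)))) hc y
    simp only [Function.comp_apply, finrank_euclideanSpace, Fintype.card_fin] at h1
    have h2 (x : EuclideanSpace ℝ (Fin 3)) : rescale c s y g (t, x) ^ 10 =
        ENNReal.ofReal (c⁻¹ ^ 5) * g (c⁻¹ • (t - s), c⁻¹ • (x - y)) ^ 10 := by
      rw [rescale, mul_pow, ofReal_sqrt_pow (inv_nonneg.2 hc.le) 5, rescaleMap, smul_eq_mul,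
        div_eq_inv_mul]
    simp only [h2]
    rw [lintegral_const_mul' _ _ ENNReal.ofReal_ne_top, h1, ← mul_assoc,
      ← ENNReal.ofReal_mul (by positivity), ENNReal.mul_rpow_of_nonneg _ _ (by norm_num),
      show c⁻¹ ^ 5 * c ^ 3 = c⁻¹ ^ 2 by field_simp, ENNReal.ofReal_pow (by positivity),
      ← ENNReal.rpow_natCast, ← ENNReal.rpow_mul]
    norm_num
  unfold lmixedNorm
  simp only [inner]
  rw [lintegral_const_mul' _ _ ENNReal.ofReal_ne_top,
    lintegral_comp_inv_smul_sub volume (measurable_lintegral_rpow_half hg10) hc s,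
    ← mul_assoc, ← ENNReal.ofReal_mul (by positivity)]
  simp [hc.ne']

/-- The tails left by truncation vanish in the limit. -/
lemma tendsto_lmixedNorm_truncation {f : ℝ × EuclideanSpace ℝ (Fin 3) → ℝ≥0∞}
    (hf : Measurable f) (hfin : ∀ p, f p ≠ ∞) (hN : lmixedNorm f ≠ ∞) :
    Tendsto (fun k => lmixedNorm ((truncationSet f k)ᶜ.indicator f)) atTop (𝓝 0) := by
  have hf10 : Measurable fun p => f p ^ 10 := hf.pow_const 10
  have hm (k : ℕ) : Measurable fun p => (truncationSet f k)ᶜ.indicator f p ^ 10 :=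
    (hf.indicator (measurableSet_truncationSet hf k).compl).pow_const 10
  have hle (k : ℕ) (p) : (truncationSet f k)ᶜ.indicator f p ^ 10 ≤ f p ^ 10 := by
    gcongr
    exact Set.indicator_le_self _ _ _
  have hae := ae_lt_top (measurable_lintegral_rpow_half hf10) hN
  rw [← lintegral_zero (μ := (volume : Measure ℝ))]
  refine tendsto_lintegral_of_dominated_convergence
    (fun t => (∫⁻ x, f (t, x) ^ 10) ^ ((1 : ℝ) / 2))
    (fun k => measurable_lintegral_rpow_half (hm k))
    (fun k => .of_forall fun t => ENNReal.rpow_le_rpow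
      (lintegral_mono fun x => hle k (t, x)) (by norm_num)) hN ?_
  filter_upwards [hae] with t ht
  have ht' : ∫⁻ x, f (t, x) ^ 10 ≠ ∞ := by
    intro h
    simp [h] at ht
  have hlim : Tendsto (fun k => ∫⁻ x, (truncationSet f k)ᶜ.indicator f (t, x) ^ 10)
      atTop (𝓝 0) := by
    rw [← lintegral_zero (μ := (volume : Measure (EuclideanSpace ℝ (Fin 3))))]
    refine tendsto_lintegral_of_dominated_convergence (fun x => f (t, x) ^ 10)
      (fun k => (hm k).comp measurable_prodMk_left)
      (fun k => .of_forall fun x => hle k (t, x)) ht' (.of_forall fun x => ?_)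
    refine tendsto_const_nhds.congr' ?_
    filter_upwards [eventually_mem_truncationSet (hfin (t, x))] with k hk
    simp [hk]
  simpa using hlim.ennrpow_const ((1 : ℝ) / 2)

lemma lmixedForm_le_add_of_le {f g f₁ g₁ f₂ g₂ : ℝ × EuclideanSpace ℝ (Fin 3) → ℝ≥0∞}
    (hf₁ : Measurable f₁) (hg₁ : Measurable g₁)
    (h : ∀ p, f p ^ 8 * g p ^ 2 ≤ f₁ p ^ 8 * g₁ p ^ 2 + f₂ p ^ 8 * g₂ p ^ 2) :
    lmixedForm f g ≤ lmixedForm f₁ g₁ + lmixedForm f₂ g₂ := by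
  have hm : Measurable fun p => f₁ p ^ 8 * g₁ p ^ 2 := (hf₁.pow_const 8).mul (hg₁.pow_const 2)
  unfold lmixedForm
  rw [← lintegral_add_left (measurable_lintegral_rpow_half hm)]
  refine lintegral_mono fun t => ?_
  refine le_trans ?_ (ENNReal.rpow_add_le_add_rpow _ _ (by norm_num) (by norm_num))
  refine ENNReal.rpow_le_rpow ?_ (by norm_num)
  exact (lintegral_mono fun x => h (t, x)).trans_eq
    (lintegral_add_left (hm.comp measurable_prodMk_left) _)

lemma lmixedForm_le_indicator_add {f g : ℝ × EuclideanSpace ℝ (Fin 3) → ℝ≥0∞}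
    (hf : Measurable f) (hg : Measurable g) {A B : Set (ℝ × EuclideanSpace ℝ (Fin 3))}
    (hA : MeasurableSet A) (hB : MeasurableSet B) :
    lmixedForm f g ≤ lmixedForm (A.indicator f) (B.indicator g) +
      (lmixedForm (Aᶜ.indicator f) g + lmixedForm f (Bᶜ.indicator g)) := by
  calc lmixedForm f g ≤ lmixedForm (A.indicator f) g + lmixedForm (Aᶜ.indicator f) g :=
        lmixedForm_le_add_of_le (hf.indicator hA) hg fun p => by by_cases p ∈ A <;> simp [*]
    _ ≤ lmixedForm (A.indicator f) (B.indicator g) + lmixedForm f (Bᶜ.indicator g) +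
          lmixedForm (Aᶜ.indicator f) g := by
        gcongr
        exact lmixedForm_le_add_of_le (hf.indicator hA) (hg.indicator hB) fun p => by
          by_cases p ∈ A <;> by_cases p ∈ B <;> simp [*]
    _ = _ := by rw [add_assoc, add_comm (lmixedForm f _)]

lemma lmixedForm_le_of_le_on {f g : ℝ × EuclideanSpace ℝ (Fin 3) → ℝ≥0∞} {M : ℝ≥0∞}
    {S : Set ℝ} {Q : Set (EuclideanSpace ℝ (Fin 3))} (hS : MeasurableSet S)
    (hQ : MeasurableSet Q) (hM : ∀ p, f p ^ 8 * g p ^ 2 ≤ M)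
    (hsupp : ∀ t x, f (t, x) ^ 8 * g (t, x) ^ 2 ≠ 0 → t ∈ S ∧ x ∈ Q) :
    lmixedForm f g ≤ (M * volume Q) ^ ((1 : ℝ) / 2) * volume S := by
  calc lmixedForm f g
      ≤ ∫⁻ t, S.indicator (fun _ => (M * volume Q) ^ ((1 : ℝ) / 2)) t := by
        refine lintegral_mono fun t => ?_
        by_cases ht : t ∈ S
        · rw [Set.indicator_of_mem ht, ← lintegral_indicator_const hQ]
          refine ENNReal.rpow_le_rpow (lintegral_mono fun x => ?_) (by norm_num)
          by_cases hx : x ∈ Q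
          · simpa [hx] using hM (t, x)
          · have : f (t, x) ^ 8 * g (t, x) ^ 2 = 0 := by
              by_contra h
              exact hx (hsupp t x h).2
            exact this.trans_le zero_le
        · have hzero (x) : f (t, x) ^ 8 * g (t, x) ^ 2 = 0 := by
            by_contra h
            exact ht (hsupp t x h).1
          simp [hzero]
    _ = _ := lintegral_indicator_const hS _

lemma indicator_preimage_rescale (c s : ℝ) (y : EuclideanSpace ℝ (Fin 3))
    (g : ℝ × EuclideanSpace ℝ (Fin 3) → ℝ≥0∞) (B : Set (ℝ × EuclideanSpace ℝ (Fin 3))) :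
    (rescaleMap c s y ⁻¹' B).indicator (rescale c s y g) = rescale c s y (B.indicator g) := by
  ext p
  by_cases h : rescaleMap c s y p ∈ B <;> simp [rescale, h]

lemma mem_closedBall_of_norm_rescaleMap_le {c s r : ℝ} {y : EuclideanSpace ℝ (Fin 3)}
    (hc : 0 < c) {p : ℝ × EuclideanSpace ℝ (Fin 3)} (h : ‖rescaleMap c s y p‖ ≤ r) :
    p.1 ∈ Metric.closedBall s (r * c) ∧ p.2 ∈ Metric.closedBall y (r * c) := by
  obtain ⟨h1, h2⟩ := (norm_prod_le_iff (x := rescaleMap c s y p)).1 h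
  simp only [rescaleMap, norm_div, norm_smul, norm_inv, Real.norm_of_nonneg hc.le] at h1 h2
  rw [div_le_iff₀ hc] at h1
  rw [inv_mul_le_iff₀ hc, mul_comm] at h2
  exact ⟨by rwa [mem_closedBall_iff_norm], by rwa [mem_closedBall_iff_norm]⟩

lemma truncated_mul_le (f g : ℝ × EuclideanSpace ℝ (Fin 3) → ℝ≥0∞) (k : ℕ) {c : ℝ}
    (hc : 0 < c) (s : ℝ) (y : EuclideanSpace ℝ (Fin 3)) (p : ℝ × EuclideanSpace ℝ (Fin 3)) :
    (truncationSet f k).indicator f p ^ 8 *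
      rescale c s y ((truncationSet g k).indicator g) p ^ 2 ≤
        (k : ℝ≥0∞) ^ 10 * ENNReal.ofReal c⁻¹ := by
  have hle (h : ℝ × EuclideanSpace ℝ (Fin 3) → ℝ≥0∞) (q) :
      (truncationSet h k).indicator h q ≤ k :=
    Set.indicator_apply_le' (fun hq => hq.2) fun _ => zero_le
  have hsq := ofReal_sqrt_pow (inv_nonneg.2 hc.le) 1
  rw [rescale, mul_pow, ← mul_one 2, hsq, mul_one, pow_one]
  calc _ ≤ (k : ℝ≥0∞) ^ 8 * (ENNReal.ofReal c⁻¹ * (k : ℝ≥0∞) ^ 2) := by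
        gcongr <;> exact hle _ _
    _ = _ := by ring

lemma mem_truncationSet_of_mul_ne_zero {f g : ℝ × EuclideanSpace ℝ (Fin 3) → ℝ≥0∞} {k : ℕ}
    {c s : ℝ} {y : EuclideanSpace ℝ (Fin 3)} {p : ℝ × EuclideanSpace ℝ (Fin 3)}
    (h : (truncationSet f k).indicator f p ^ 8 *
      rescale c s y ((truncationSet g k).indicator g) p ^ 2 ≠ 0) :
    p ∈ truncationSet f k ∧ rescaleMap c s y p ∈ truncationSet g k := by
  constructor <;> by_contra hp <;> simp [rescale, hp] at h

/-- The truncated mixed term vanishes as the scale tends to infinity. -/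
lemma tendsto_lmixedForm_truncated_atTop (f g : ℝ × EuclideanSpace ℝ (Fin 3) → ℝ≥0∞) (k : ℕ)
    {lam : ℕ → ℝ} (hlam : ∀ n, 0 < lam n) (hlim : Tendsto lam atTop atTop)
    (s : ℕ → ℝ) (y : ℕ → EuclideanSpace ℝ (Fin 3)) :
    Tendsto (fun n => lmixedForm ((truncationSet f k).indicator f)
      (rescale (lam n) (s n) (y n) ((truncationSet g k).indicator g))) atTop (𝓝 0) := by
  have hbound (n : ℕ) := lmixedForm_le_of_le_on
    (S := Metric.closedBall 0 k) (Q := Metric.closedBall 0 k)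
    Metric.isClosed_closedBall.measurableSet Metric.isClosed_closedBall.measurableSet
    (truncated_mul_le f g k (hlam n) (s n) (y n)) fun t x h => by
      have hp := norm_prod_le_iff.1 (mem_truncationSet_of_mul_ne_zero h).1.1
      simpa using hp
  refine tendsto_of_tendsto_of_tendsto_of_le_of_le tendsto_const_nhds ?_
    (fun n => zero_le) hbound
  have hinv : Tendsto (fun n => ENNReal.ofReal (lam n)⁻¹) atTop (𝓝 0) := by
    simpa using ENNReal.tendsto_ofReal (tendsto_inv_atTop_zero.comp hlim)
  have h1 := ENNReal.Tendsto.const_mul (a := (k : ℝ≥0∞) ^ 10) hinv (.inr (by finiteness))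
  have h2 := ENNReal.Tendsto.mul_const
    (b := volume (Metric.closedBall (0 : EuclideanSpace ℝ (Fin 3)) k)) h1
    (.inr measure_closedBall_lt_top.ne)
  have h3 := ENNReal.Tendsto.mul_const (b := volume (Metric.closedBall (0 : ℝ) k))
    (h2.ennrpow_const ((1 : ℝ) / 2)) (.inr measure_closedBall_lt_top.ne)
  simpa using h3

/-- The truncated mixed term vanishes as the scale tends to zero. -/
lemma tendsto_lmixedForm_truncated_zero (f g : ℝ × EuclideanSpace ℝ (Fin 3) → ℝ≥0∞) (k : ℕ)
    {lam : ℕ → ℝ} (hlam : ∀ n, 0 < lam n) (hlim : Tendsto lam atTop (𝓝 0))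
    (s : ℕ → ℝ) (y : ℕ → EuclideanSpace ℝ (Fin 3)) :
    Tendsto (fun n => lmixedForm ((truncationSet f k).indicator f)
      (rescale (lam n) (s n) (y n) ((truncationSet g k).indicator g))) atTop (𝓝 0) := by
  have hbound (n : ℕ) := lmixedForm_le_of_le_on
    (S := Metric.closedBall (s n) (k * lam n)) (Q := Metric.closedBall (y n) (k * lam n))
    Metric.isClosed_closedBall.measurableSet Metric.isClosed_closedBall.measurableSet
    (truncated_mul_le f g k (hlam n) (s n) (y n)) fun t x h =>
      mem_closedBall_of_norm_rescaleMap_le (hlam n) (mem_truncationSet_of_mul_ne_zero h).2.1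
  refine tendsto_of_tendsto_of_tendsto_of_le_of_le tendsto_const_nhds ?_
    (fun n => zero_le) hbound
  have hvol (n : ℕ) : (k : ℝ≥0∞) ^ 10 * ENNReal.ofReal (lam n)⁻¹ *
      volume (Metric.closedBall (y n) (k * lam n)) =
      (k : ℝ≥0∞) ^ 10 * ENNReal.ofReal (k ^ 3 * lam n ^ 2) *
        volume (Metric.ball (0 : EuclideanSpace ℝ (Fin 3)) 1) := by
    have hn := hlam n
    rw [Measure.addHaar_closedBall _ _ (by positivity), finrank_euclideanSpace,
      Fintype.card_fin, ← mul_assoc, mul_assoc (_ ^ 10), ← ENNReal.ofReal_mul (by positivity),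
      show (lam n)⁻¹ * (k * lam n) ^ 3 = k ^ 3 * lam n ^ 2 by field_simp]
  simp only [hvol, Real.volume_closedBall]
  have hsq : Tendsto (fun n => ENNReal.ofReal (k ^ 3 * lam n ^ 2)) atTop (𝓝 0) := by
    simpa only [ne_eq, OfNat.ofNat_ne_zero, not_false_eq_true, zero_pow, mul_zero,
      ENNReal.ofReal_zero] using ENNReal.tendsto_ofReal ((hlim.pow 2).const_mul ((k : ℝ) ^ 3))
  have hlin : Tendsto (fun n => ENNReal.ofReal (2 * (k * lam n))) atTop (𝓝 0) := by
    simpa using ENNReal.tendsto_ofReal ((hlim.const_mul (k : ℝ)).const_mul 2)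
  have h1 := ENNReal.Tendsto.const_mul (a := (k : ℝ≥0∞) ^ 10) hsq (.inr (by finiteness))
  have h2 := ENNReal.Tendsto.mul_const
    (b := volume (Metric.ball (0 : EuclideanSpace ℝ (Fin 3)) 1)) h1
    (.inr measure_ball_lt_top.ne)
  have h3 := ENNReal.Tendsto.mul (h2.ennrpow_const ((1 : ℝ) / 2)) (.inr (by simp)) hlin
    (.inr (by simp))
  simpa using h3

/-- Orthogonality decay of the mixed term under a scaling mismatch. -/
lemma tendsto_lmixedForm_rescale {f g : ℝ × EuclideanSpace ℝ (Fin 3) → ℝ≥0∞}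
    (hf : Measurable f) (hg : Measurable g) (hfin : ∀ p, f p ≠ ∞) (hgin : ∀ p, g p ≠ ∞)
    (hNf : lmixedNorm f ≠ ∞) (hNg : lmixedNorm g ≠ ∞)
    {lam : ℕ → ℝ} (hlam : ∀ n, 0 < lam n)
    (hlim : Tendsto lam atTop (𝓝 0) ∨ Tendsto lam atTop atTop)
    (s : ℕ → ℝ) (y : ℕ → EuclideanSpace ℝ (Fin 3)) :
    Tendsto (fun n => lmixedForm f (rescale (lam n) (s n) (y n) g)) atTop (𝓝 0) := by
  set err : ℕ → ℝ≥0∞ := fun k =>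
    lmixedNorm ((truncationSet f k)ᶜ.indicator f) ^ ((4 : ℝ) / 5) * lmixedNorm g ^ ((1 : ℝ) / 5) +
    lmixedNorm f ^ ((4 : ℝ) / 5) * lmixedNorm ((truncationSet g k)ᶜ.indicator g) ^ ((1 : ℝ) / 5)
    with herr
  have herr_lim : Tendsto err atTop (𝓝 0) := by
    have h1 := ENNReal.Tendsto.mul_const (b := lmixedNorm g ^ ((1 : ℝ) / 5))
      ((tendsto_lmixedNorm_truncation hf hfin hNf).ennrpow_const ((4 : ℝ) / 5))
      (.inr (ENNReal.rpow_ne_top_of_nonneg (by norm_num) hNg))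
    have h2 := ENNReal.Tendsto.const_mul (a := lmixedNorm f ^ ((4 : ℝ) / 5))
      ((tendsto_lmixedNorm_truncation hg hgin hNg).ennrpow_const ((1 : ℝ) / 5))
      (.inr (ENNReal.rpow_ne_top_of_nonneg (by norm_num) hNf))
    simpa [herr] using h1.add h2
  have hle (k n : ℕ) : lmixedForm f (rescale (lam n) (s n) (y n) g) ≤
      lmixedForm ((truncationSet f k).indicator f)
        (rescale (lam n) (s n) (y n) ((truncationSet g k).indicator g)) + err k := by
    have hA := measurableSet_truncationSet hf k
    have hB := measurableSet_truncationSet hg k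
    have hg' := hg.rescale (lam n) (s n) (y n)
    refine (lmixedForm_le_indicator_add hf hg' hA
      (measurable_rescaleMap (lam n) (s n) (y n) hB)).trans ?_
    rw [← Set.preimage_compl, indicator_preimage_rescale, indicator_preimage_rescale]
    refine add_le_add le_rfl (add_le_add ?_ ?_)
    · refine (lmixedForm_le (hf.indicator hA.compl) hg').trans_eq ?_
      rw [lmixedNorm_rescale hg (hlam n)]
    · refine (lmixedForm_le hf ((hg.indicator hB.compl).rescale _ _ _)).trans_eq ?_
      rw [lmixedNorm_rescale (hg.indicator hB.compl) (hlam n)]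
  rw [ENNReal.tendsto_nhds_zero] at herr_lim ⊢
  intro ε hε
  have hε2 : 0 < ε / 2 := ENNReal.half_pos hε.ne'
  obtain ⟨k, hk⟩ := (herr_lim _ hε2).exists
  have hmain := hlim.elim
    (fun h => tendsto_lmixedForm_truncated_zero f g k hlam h s y)
    (fun h => tendsto_lmixedForm_truncated_atTop f g k hlam h s y)
  filter_upwards [ENNReal.tendsto_nhds_zero.1 hmain _ hε2] with n hn
  exact (hle k n).trans ((add_le_add hn hk).trans_eq (ENNReal.add_halves ε))

/-- **Scaling-mismatch case of the mixed-term orthogonality decay (cases (A.2), (A.4)–(A.6)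
of Lemma 6.2).** For `U, V` with finite `L⁵_t L¹⁰_x` norm and positive scales `λ_n → 0` or
`λ_n → ∞`, and arbitrary translations `(t_n, x_n)`,
`∫_ℝ (∫_{ℝ³} |U(t,x)|⁸ λ_n⁻¹ |V((t − t_n)/λ_n, (x − x_n)/λ_n)|² dx)^{1/2} dt → 0`. -/
theorem stmt11 (U V : ℝ × EuclideanSpace ℝ (Fin 3) → ℝ)
    (hU : Measurable U) (hV : Measurable V)
    (hNU : mixedNorm510 U < ⊤) (hNV : mixedNorm510 V < ⊤)
    (lam : ℕ → ℝ) (hlam : ∀ n, 0 < lam n)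
    (hlamlim : Tendsto lam atTop (𝓝 0) ∨ Tendsto lam atTop atTop)
    (tseq : ℕ → ℝ) (xseq : ℕ → EuclideanSpace ℝ (Fin 3)) :
    Tendsto (fun n =>
        ∫⁻ t : ℝ, (∫⁻ x : EuclideanSpace ℝ (Fin 3),
          ENNReal.ofReal (|U (t, x)| ^ 8 * (lam n)⁻¹ *
            |V ((t - tseq n) / lam n, (lam n)⁻¹ • (x - xseq n))| ^ 2)) ^ ((1 : ℝ) / 2))
      atTop (𝓝 0) := by
  have hlift (W : ℝ × EuclideanSpace ℝ (Fin 3) → ℝ) :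
      lmixedNorm (fun p => ENNReal.ofReal |W p|) = mixedNorm510 W := by
    simp only [lmixedNorm, mixedNorm510, ENNReal.ofReal_pow (abs_nonneg _)]
  have h := tendsto_lmixedForm_rescale (f := fun p => ENNReal.ofReal |U p|)
    (g := fun p => ENNReal.ofReal |V p|) hU.abs.ennreal_ofReal hV.abs.ennreal_ofReal
    (fun _ => ENNReal.ofReal_ne_top) (fun _ => ENNReal.ofReal_ne_top)
    (by rw [hlift]; exact hNU.ne) (by rw [hlift]; exact hNV.ne) hlam hlamlim tseq xseq
  refine h.congr fun n => lintegral_congr fun t => ?_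
  congr 1
  refine lintegral_congr fun x => ?_
  have hc : 0 ≤ (lam n)⁻¹ := inv_nonneg.2 (hlam n).le
  have hsq : ENNReal.ofReal √(lam n)⁻¹ ^ 2 = ENNReal.ofReal (lam n)⁻¹ := by
    simpa using ofReal_sqrt_pow hc 1
  rw [ENNReal.ofReal_mul (by positivity), ENNReal.ofReal_mul (by positivity),
    ENNReal.ofReal_pow (abs_nonneg _), ENNReal.ofReal_pow (abs_nonneg _), rescale, mul_pow,
    hsq, mul_assoc, rescaleMap]
end
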